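/- Let n and k be integers with 10^37 ≤ k ≤ n. Then there exists a subset S of the grid [n]² of size exactly kn such that every affine line in ℝ² contains at most k points of S. -/

import Mathlib

open Set

noncomputable section

/-- The grid `[n]² = {1,…,n}²` regarded as a subset of `ℝ²`. -/
def grid2 (n : ℕ) : Set (ℝ × ℝ) :=
  {p | ∃ a b : ℤ, 1 ≤ a ∧ a ≤ (n : ℤ) ∧ 1 ≤ b ∧ b ≤ (n : ℤ) ∧ p = ((a : ℝ), (b : ℝ))}

/-- An (affine) line in `ℝ²`: a one-dimensional affine subspace of `ℝ²`. -/
def IsLine (L : AffineSubspace ℝ (ℝ × ℝ)) : Prop :=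
  Module.finrank ℝ L.direction = 1

/-- Membership in `𝓛`: lines intersecting the grid `[n]²` in at least two points. -/
def InLines (n : ℕ) (L : AffineSubspace ℝ (ℝ × ℝ)) : Prop :=
  IsLine L ∧ 2 ≤ (grid2 n ∩ (L : Set (ℝ × ℝ))).ncard

/-- The weight `w(L) = |[n]² ∩ L| / n` of a line `L`. -/
def lineWeight (n : ℕ) (L : AffineSubspace ℝ (ℝ × ℝ)) : ℝ :=
  ((grid2 n ∩ (L : Set (ℝ × ℝ))).ncard : ℝ) / n

section LocalLemma

variable {ι : Type*} [Fintype ι] [DecidableEq ι] {Ω : ι → Type*}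

open scoped Classical in
/-- The configuration agreeing with `ω` on `V` and with `ω'` off `V`. -/
def mergeOn (V : Finset ι) (ω ω' : ∀ j, Ω j) : ∀ j, Ω j := fun j => if j ∈ V then ω j else ω' j

variable [∀ j, Fintype (Ω j)] [∀ j, DecidableEq (Ω j)]

theorem card_inter_mul_card_eq (V : Finset ι) (A B : Finset (∀ j, Ω j))
    (hA : ∀ ω ω' : ∀ j, Ω j, (∀ j ∈ V, ω j = ω' j) → ω ∈ A → ω' ∈ A)
    (hB : ∀ ω ω' : ∀ j, Ω j, (∀ j, j ∉ V → ω j = ω' j) → ω ∈ B → ω' ∈ B) :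
    (A ∩ B).card * Fintype.card (∀ j, Ω j) = A.card * B.card := by
  rw [← Finset.card_univ, ← Finset.card_product, ← Finset.card_product]
  refine Finset.card_nbij' (fun x => (mergeOn V x.1 x.2, mergeOn V x.2 x.1))
    (fun x => (mergeOn V x.1 x.2, mergeOn V x.2 x.1)) ?_ ?_ ?_ ?_
  · rintro ⟨a, b⟩ h
    simp only [Finset.coe_product, Set.mem_prod, Finset.mem_coe, Finset.mem_inter] at h ⊢
    exact ⟨hA a _ (fun j hj => by simp [mergeOn, hj]) h.1.1,
      hB a _ (fun j hj => by simp [mergeOn, hj]) h.1.2⟩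
  · rintro ⟨a, b⟩ h
    simp only [Finset.coe_product, Set.mem_prod, Finset.mem_coe, Finset.mem_inter] at h ⊢
    exact ⟨⟨hA a _ (fun j hj => by simp [mergeOn, hj]) h.1,
      hB b _ (fun j hj => by simp [mergeOn, hj]) h.2⟩, Finset.mem_univ _⟩
  · rintro ⟨a, b⟩ _
    ext j <;> by_cases hj : j ∈ V <;> simp [mergeOn, hj]
  · rintro ⟨a, b⟩ _
    ext j <;> by_cases hj : j ∈ V <;> simp [mergeOn, hj]

/-- The symmetric Lovász local lemma for the uniform measure on a finite product, with the
(slightly lossy) condition `4 p d ≤ 1`. -/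
theorem exists_forall_notMem_of_local_lemma [∀ j, Nonempty (Ω j)]
    {Λ : Type*} [Fintype Λ] [DecidableEq Λ] (B : Λ → Finset (∀ j, Ω j)) (vbl : Λ → Finset ι)
    (hB : ∀ l, ∀ ω ω' : ∀ j, Ω j, (∀ j ∈ vbl l, ω j = ω' j) → ω ∈ B l → ω' ∈ B l)
    (p : ℝ) (d : ℕ) (hd0 : 1 ≤ d)
    (hp : ∀ l, ((B l).card : ℝ) ≤ p * Fintype.card (∀ j, Ω j))
    (hd : ∀ l, (Finset.univ.filter fun l' => ¬ Disjoint (vbl l) (vbl l')).card ≤ d)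
    (hpd : 4 * p * d ≤ 1) : ∃ ω : ∀ j, Ω j, ∀ l, ω ∉ B l := by
  classical
  rcases isEmpty_or_nonempty Λ with hΛ | ⟨⟨l₀⟩⟩
  · exact ⟨fun j => Classical.arbitrary _, fun l => (hΛ.false l).elim⟩
  have hN : (0 : ℝ) < Fintype.card (∀ j, Ω j) := by exact_mod_cast Fintype.card_pos
  have hp0 : 0 ≤ p := by
    have h1 := hp l₀
    have h2 : (0 : ℝ) ≤ (B l₀).card := Nat.cast_nonneg _
    by_contra h
    nlinarith
  have hd1 : (1 : ℝ) ≤ d := by exact_mod_cast hd0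
  have hp1 : 4 * p ≤ 1 := by nlinarith
  let G : Finset Λ → Finset (∀ j, Ω j) := fun S => Finset.univ.filter fun ω => ∀ l ∈ S, ω ∉ B l
  have hG : ∀ S ω, ω ∈ G S ↔ ∀ l ∈ S, ω ∉ B l := fun S ω => by simp [G]
  have key : ∀ m : ℕ, ∀ S : Finset Λ, S.card = m → ∀ l,
      ((G S ∩ B l).card : ℝ) ≤ 2 * p * (G S).card := by
    intro m
    induction m using Nat.strong_induction_on with
    | _ m ih =>
      intro S hS l
      set S1 := S.filter fun l' => ¬ Disjoint (vbl l) (vbl l') with hS1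
      set S2 := S.filter fun l' => Disjoint (vbl l) (vbl l') with hS2
      have hind : ((G S2 ∩ B l).card : ℝ) ≤ p * (G S2).card := by
        have h := card_inter_mul_card_eq (vbl l) (B l) (G S2) (hB l) (by
          intro ω ω' h hω
          rw [hG] at hω ⊢
          intro l' hl' hc
          refine hω l' hl' (hB l' ω' ω (fun j hj => (h j fun hj' => ?_).symm) hc)
          exact Finset.disjoint_left.1 (Finset.mem_filter.1 hl').2 hj' hj)
        have h' : ((B l ∩ G S2).card : ℝ) * Fintype.card (∀ j, Ω j) =
            (B l).card * (G S2).card := by exact_mod_cast h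
        have h3 := hp l
        have h4 : (0 : ℝ) ≤ (G S2).card := Nat.cast_nonneg _
        rw [Finset.inter_comm]
        refine le_of_mul_le_mul_right ?_ hN
        rw [h']
        nlinarith
      have hsub : G S ∩ B l ⊆ G S2 ∩ B l := by
        refine Finset.inter_subset_inter_right fun ω hω => ?_
        rw [hG] at hω ⊢
        exact fun l' hl' => hω l' (Finset.mem_filter.1 hl').1
      have h1 : ((G S ∩ B l).card : ℝ) ≤ p * (G S2).card :=
        le_trans (by exact_mod_cast Finset.card_le_card hsub) hind
      have h2 : ((G S2).card : ℝ) ≤ 2 * (G S).card := by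
        rcases S1.eq_empty_or_nonempty with he | hne
        · have : S2 = S := by
            rw [hS2, Finset.filter_eq_self]
            intro x hx
            by_contra hc
            exact Finset.notMem_empty x (he ▸ Finset.mem_filter.2 ⟨hx, hc⟩)
          rw [this]
          have : (0 : ℝ) ≤ (G S).card := Nat.cast_nonneg _
          linarith
        · have hlt : S2.card < m := by
            have : S2.card + S1.card = S.card := Finset.card_filter_add_card_filter_not _
            have := hne.card_pos
            omega
          have hcov : G S2 ⊆ G S ∪ S1.biUnion fun l' => G S2 ∩ B l' := by
            intro ω hω
            by_cases hx : ω ∈ G S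
            · exact Finset.mem_union_left _ hx
            · refine Finset.mem_union_right _ ?_
              rw [hG] at hx hω
              push Not at hx
              obtain ⟨l', hl', hb⟩ := hx
              refine Finset.mem_biUnion.2 ⟨l', ?_, Finset.mem_inter.2 ⟨(hG _ _).2 hω, hb⟩⟩
              refine Finset.mem_filter.2 ⟨hl', fun hc => ?_⟩
              exact hω l' (Finset.mem_filter.2 ⟨hl', hc⟩) hb
          have hc1 : ((G S2).card : ℝ) ≤ (G S).card + ∑ l' ∈ S1, ((G S2 ∩ B l').card : ℝ) := by
            have := (Finset.card_le_card hcov).trans ((Finset.card_union_le _ _).trans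
              (Nat.add_le_add_left Finset.card_biUnion_le _))
            exact_mod_cast this
          have hc2 : ∑ l' ∈ S1, ((G S2 ∩ B l').card : ℝ) ≤ S1.card * (2 * p * (G S2).card) := by
            rw [← nsmul_eq_mul]
            exact Finset.sum_le_card_nsmul _ _ _ fun l' _ => ih _ hlt S2 rfl l'
          have hc3 : (S1.card : ℝ) ≤ d := by
            exact_mod_cast (Finset.card_le_card
              (Finset.filter_subset_filter _ (Finset.subset_univ S))).trans (hd l)
          have h4 : (0 : ℝ) ≤ (G S2).card := Nat.cast_nonneg _
          have h5 : (S1.card : ℝ) * (2 * p * (G S2).card) ≤ d * (2 * p * (G S2).card) := by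
            gcongr
          nlinarith
      nlinarith
  have pos : ∀ S : Finset Λ, (0 : ℝ) < (G S).card := by
    intro S
    induction S using Finset.induction_on with
    | empty => simpa [G] using hN
    | insert l S hl ih =>
      have h1 := key _ S rfl l
      have h2 : G S ⊆ G (insert l S) ∪ (G S ∩ B l) := by
        intro ω hω
        by_cases h : ω ∈ B l
        · exact Finset.mem_union_right _ (Finset.mem_inter.2 ⟨hω, h⟩)
        · refine Finset.mem_union_left _ ((hG _ _).2 fun l' hl' => ?_)
          rcases Finset.mem_insert.1 hl' with rfl | h'
          · exact h
          · exact (hG _ _).1 hω l' h'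
      have h3 : ((G S).card : ℝ) ≤ (G (insert l S)).card + (G S ∩ B l).card := by
        exact_mod_cast (Finset.card_le_card h2).trans (Finset.card_union_le _ _)
      nlinarith
  obtain ⟨ω, hω⟩ := Finset.card_pos.1 (by exact_mod_cast pos Finset.univ)
  exact ⟨ω, fun l => (hG _ _).1 hω l (Finset.mem_univ _)⟩

end LocalLemma

section RandomBijection

variable {α β : Type*} [Fintype α] [Fintype β] [DecidableEq α] [DecidableEq β]

theorem card_equiv_insert_le (P : α → Finset β) (Δ : ℕ) (A : Finset α) (x : α) (hx : x ∉ A)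
    (hP : (P x).card ≤ Δ) :
    (Fintype.card α - A.card) *
      (Finset.univ.filter fun ω : α ≃ β => ∀ z ∈ insert x A, ω z ∈ P z).card ≤
    Δ * (Finset.univ.filter fun ω : α ≃ β => ∀ z ∈ A, ω z ∈ P z).card := by
  rw [← Finset.card_compl]
  refine le_trans ?_ (Nat.mul_le_mul_right _ hP)
  rw [← Finset.card_product, ← Finset.card_product]
  refine Finset.card_le_card_of_injOn
    (fun q => (q.2 x, (Equiv.swap x q.1).trans q.2)) ?_ ?_
  · rintro ⟨u, ω⟩ h
    simp only [Finset.coe_product, Set.mem_prod, Finset.mem_coe, Finset.mem_compl,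
      Finset.mem_filter, Finset.mem_univ, true_and, Finset.mem_insert, forall_eq_or_imp,
      Equiv.trans_apply] at h ⊢
    obtain ⟨hu, h1, h2⟩ := h
    refine ⟨h1, fun z hz => ?_⟩
    rw [Equiv.swap_apply_of_ne_of_ne]
    · exact h2 z hz
    · rintro rfl; exact hx hz
    · rintro rfl; exact hu hz
  · rintro ⟨u, ω⟩ _ ⟨u', ω'⟩ _ h
    simp only [Prod.mk.injEq] at h
    obtain ⟨h1, h2⟩ := h
    have h3 : ω' x = ((Equiv.swap x u').trans ω') u' := by simp
    have h4 : ω x = ((Equiv.swap x u).trans ω) u := by simp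
    have huu : u = u' := by
      apply ((Equiv.swap x u).trans ω).injective
      rw [← h4, h1, h3, h2]
    subst huu
    have : ω = ω' := by
      have := congrArg (fun e => (Equiv.swap x u).trans e) h2
      simpa [← Equiv.trans_assoc] using this
    rw [this]

theorem card_equiv_forall_mem_le (P : α → Finset β) (Δ t d : ℕ) (htd : t < d)
    (hd : d ≤ Fintype.card α) (A : Finset α) (hA : A.card ≤ t)
    (hP : ∀ x ∈ A, (P x).card ≤ Δ) :
    ((Finset.univ.filter fun ω : α ≃ β => ∀ z ∈ A, ω z ∈ P z).card : ℝ) ≤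
      ((Δ : ℝ) / (d - t)) ^ A.card * Fintype.card (α ≃ β) := by
  have hdt : (0 : ℝ) < (d : ℝ) - t := by
    have : (t : ℝ) < d := by exact_mod_cast htd
    linarith
  induction A using Finset.induction_on with
  | empty => simp
  | insert x A hx ih =>
    rw [Finset.card_insert_of_notMem hx] at hA ⊢
    have ih' := ih (by omega) fun z hz => hP z (Finset.mem_insert_of_mem hz)
    have h := card_equiv_insert_le P Δ A x hx (hP x (Finset.mem_insert_self _ _))
    have h' : ((d : ℝ) - t) *
        ((Finset.univ.filter fun ω : α ≃ β => ∀ z ∈ insert x A, ω z ∈ P z).card : ℝ) ≤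
        Δ * (Finset.univ.filter fun ω : α ≃ β => ∀ z ∈ A, ω z ∈ P z).card := by
      refine le_trans ?_ (by exact_mod_cast h : (((Fintype.card α - A.card : ℕ) : ℝ) *
        ((Finset.univ.filter fun ω : α ≃ β => ∀ z ∈ insert x A, ω z ∈ P z).card : ℝ)) ≤
        Δ * (Finset.univ.filter fun ω : α ≃ β => ∀ z ∈ A, ω z ∈ P z).card)
      gcongr
      have : d - t ≤ Fintype.card α - A.card := by omega
      have h2 : ((d - t : ℕ) : ℝ) ≤ ((Fintype.card α - A.card : ℕ) : ℝ) := by exact_mod_cast this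
      rwa [Nat.cast_sub htd.le] at h2
    rw [pow_succ']
    have h3 : ((Finset.univ.filter fun ω : α ≃ β => ∀ z ∈ insert x A, ω z ∈ P z).card : ℝ) ≤
        (Δ : ℝ) / (d - t) * (Finset.univ.filter fun ω : α ≃ β => ∀ z ∈ A, ω z ∈ P z).card := by
      rw [div_mul_eq_mul_div, le_div_iff₀ hdt]
      linarith
    refine h3.trans ?_
    rw [mul_assoc]
    gcongr

end RandomBijection

section Tail

variable {ι : Type*} [Fintype ι] [DecidableEq ι] {α β : ι → Type*}
  [∀ j, Fintype (α j)] [∀ j, Fintype (β j)] [∀ j, DecidableEq (α j)] [∀ j, DecidableEq (β j)]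

theorem card_pi_equiv_forall_mem_le (P : ∀ x : (Σ j, α j), Finset (β x.1)) (Δ t d : ℕ)
    (htd : t < d) (hd : ∀ j, d ≤ Fintype.card (α j)) (A : Finset (Σ j, α j)) (hA : A.card = t)
    (hP : ∀ x ∈ A, (P x).card ≤ Δ) :
    ((Finset.univ.filter fun ω : ∀ j, α j ≃ β j => ∀ x ∈ A, ω x.1 x.2 ∈ P x).card : ℝ) ≤
      ((Δ : ℝ) / (d - t)) ^ t * Fintype.card (∀ j, α j ≃ β j) := by
  let Aj : ∀ j, Finset (α j) := fun j => Finset.univ.filter fun x => (⟨j, x⟩ : Σ j, α j) ∈ A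
  have hsum : ∑ j, (Aj j).card = A.card := by
    rw [← Finset.card_sigma]
    congr 1
    ext ⟨j, x⟩
    simp [Aj]
  have hset : (Finset.univ.filter fun ω : ∀ j, α j ≃ β j => ∀ x ∈ A, ω x.1 x.2 ∈ P x) =
      Fintype.piFinset fun j => Finset.univ.filter fun ω : α j ≃ β j =>
        ∀ x ∈ Aj j, ω x ∈ P ⟨j, x⟩ := by
    ext ω
    simp [Aj, Sigma.forall]
  rw [hset, Fintype.card_piFinset, Fintype.card_pi, ← hA, ← hsum, ← Finset.prod_pow_eq_pow_sum]
  push_cast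
  rw [← Finset.prod_mul_distrib]
  refine Finset.prod_le_prod (fun _ _ => Nat.cast_nonneg _) fun j _ => ?_
  have hcard : (Aj j).card ≤ A.card := by
    rw [← hsum]
    exact Finset.single_le_sum (f := fun j => (Aj j).card) (fun _ _ => Nat.zero_le _)
      (Finset.mem_univ j)
  have := card_equiv_forall_mem_le (β := β j) (fun x : α j => P ⟨j, x⟩) Δ t d htd (hd j) (Aj j)
    (hA ▸ hcard) fun x hx => hP ⟨j, x⟩ (by simpa [Aj] using hx)
  rw [← hA, ← hsum] at this
  exact_mod_cast this

/-- Upper tail bound for the number of constraints `ω x ∈ P x`, `x ∈ E`, met by a tuple of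
independent uniform bijections. -/
theorem card_pi_equiv_tail_le (P : ∀ x : (Σ j, α j), Finset (β x.1)) (Δ t d T L : ℕ)
    (htd : t < d) (htT : t ≤ T)
    (hd : ∀ j, d ≤ Fintype.card (α j)) (E : Finset (Σ j, α j)) (hE : E.card ≤ L)
    (hP : ∀ x ∈ E, (P x).card ≤ Δ) :
    ((Finset.univ.filter fun ω : ∀ j, α j ≃ β j =>
        T ≤ (E.filter fun x => ω x.1 x.2 ∈ P x).card).card : ℝ) ≤
      (L * ((Δ : ℝ) / (d - t)) / (T + 1 - t)) ^ t * Fintype.card (∀ j, α j ≃ β j) := by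
  set bad := Finset.univ.filter fun ω : ∀ j, α j ≃ β j =>
        T ≤ (E.filter fun x => ω x.1 x.2 ∈ P x).card with hbad
  set N : ℝ := (Fintype.card (∀ j, α j ≃ β j) : ℝ)
  set q : ℝ := (Δ : ℝ) / (d - t) with hq
  have hN : 0 ≤ N := Nat.cast_nonneg _
  have hq0 : 0 ≤ q := by
    have : (t : ℝ) < d := by exact_mod_cast htd
    exact div_nonneg (Nat.cast_nonneg _) (by linarith)
  have hTt : (0 : ℝ) < T + 1 - t := by
    have : (t : ℝ) ≤ T := by exact_mod_cast htT
    linarith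
  have h1 : bad.card * T.choose t ≤ ∑ A ∈ E.powersetCard t,
      (Finset.univ.filter fun ω : ∀ j, α j ≃ β j => ∀ x ∈ A, ω x.1 x.2 ∈ P x).card := by
    have : ∑ A ∈ E.powersetCard t,
      (Finset.univ.filter fun ω : ∀ j, α j ≃ β j => ∀ x ∈ A, ω x.1 x.2 ∈ P x).card =
      ∑ ω : ∀ j, α j ≃ β j, ((E.powersetCard t).filter fun A => ∀ x ∈ A, ω x.1 x.2 ∈ P x).card := by
      exact Finset.sum_card_bipartiteAbove_eq_sum_card_bipartiteBelow
        (fun A (ω : ∀ j, α j ≃ β j) => ∀ x ∈ A, ω x.1 x.2 ∈ P x)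
    rw [this]
    refine le_trans ?_ (Finset.sum_le_sum_of_subset (Finset.subset_univ bad))
    rw [← smul_eq_mul]
    refine Finset.card_nsmul_le_sum _ _ _ fun ω hω => ?_
    have hω' := (Finset.mem_filter.1 hω).2
    refine (Nat.choose_le_choose t hω').trans ?_
    rw [← Finset.card_powersetCard]
    refine Finset.card_le_card fun A hA => ?_
    rw [Finset.mem_powersetCard] at hA
    refine Finset.mem_filter.2 ⟨Finset.mem_powersetCard.2
      ⟨hA.1.trans (Finset.filter_subset _ _), hA.2⟩, fun x hx => ?_⟩
    exact (Finset.mem_filter.1 (hA.1 hx)).2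
  have h2 : (bad.card : ℝ) * T.choose t ≤ L.choose t * (q ^ t * N) := by
    have h1' : (bad.card : ℝ) * T.choose t ≤ ∑ A ∈ E.powersetCard t,
      ((Finset.univ.filter fun ω : ∀ j, α j ≃ β j =>
        ∀ x ∈ A, ω x.1 x.2 ∈ P x).card : ℝ) := by exact_mod_cast h1
    refine h1'.trans ((Finset.sum_le_card_nsmul _ _ (q ^ t * N) fun A hA => ?_).trans ?_)
    · rw [Finset.mem_powersetCard] at hA
      exact card_pi_equiv_forall_mem_le P Δ t d htd hd A hA.2 fun x hx => hP x (hA.1 hx)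
    · rw [nsmul_eq_mul, Finset.card_powersetCard]
      gcongr
  have h3 : (L.choose t : ℝ) * t.factorial ≤ (L : ℝ) ^ t := by
    have := Nat.descFactorial_le_pow L t
    rw [Nat.descFactorial_eq_factorial_mul_choose, mul_comm] at this
    exact_mod_cast this
  have h4 : ((T : ℝ) + 1 - t) ^ t ≤ (T.choose t : ℝ) * t.factorial := by
    have := Nat.pow_sub_le_descFactorial T t
    rw [Nat.descFactorial_eq_factorial_mul_choose, mul_comm] at this
    have h5 : (((T + 1 - t : ℕ) : ℝ)) ^ t ≤ (T.choose t : ℝ) * t.factorial := by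
      exact_mod_cast this
    rw [Nat.cast_sub (by omega)] at h5
    exact_mod_cast h5
  have hf : (0 : ℝ) < t.factorial := by exact_mod_cast t.factorial_pos
  rw [div_pow, mul_pow, div_mul_eq_mul_div, le_div_iff₀ (by positivity)]
  calc (bad.card : ℝ) * ((T : ℝ) + 1 - t) ^ t ≤ bad.card * (T.choose t * t.factorial) := by gcongr
    _ = (bad.card * T.choose t) * t.factorial := by ring
    _ ≤ (L.choose t * (q ^ t * N)) * t.factorial := by gcongr
    _ = (L.choose t * t.factorial) * (q ^ t * N) := by ring
    _ ≤ (L : ℝ) ^ t * (q ^ t * N) := by gcongr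
    _ = _ := by ring

/-- Bijections `ω j` can be selected so that no index `l` has `T l` of its constraints met. -/
theorem exists_equiv_forall_card_lt [∀ j, Nonempty (α j ≃ β j)] {Λ : Type*} [Fintype Λ]
    [DecidableEq Λ] (E : Λ → Finset (Σ j, α j)) (P : Λ → ∀ x : (Σ j, α j), Finset (β x.1))
    (Δ d : ℕ) (t T L : Λ → ℕ) (hd : ∀ j, d ≤ Fintype.card (α j))
    (htd : ∀ l, t l < d) (htT : ∀ l, t l ≤ T l)
    (hE : ∀ l, (E l).card ≤ L l) (hP : ∀ l, ∀ x ∈ E l, (P l x).card ≤ Δ)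
    (p : ℝ) (g : ℕ) (hg0 : 1 ≤ g)
    (hg : ∀ l, (Finset.univ.filter fun l' =>
      ∃ x ∈ E l, ∃ y ∈ E l', x.1 = y.1).card ≤ g)
    (hp : ∀ l, (L l * ((Δ : ℝ) / (d - t l)) / (T l + 1 - t l)) ^ (t l) ≤ p)
    (hpg : 4 * p * g ≤ 1) :
    ∃ ω : ∀ j, α j ≃ β j, ∀ l, ((E l).filter fun x => ω x.1 x.2 ∈ P l x).card < T l := by
  refine (exists_forall_notMem_of_local_lemma
    (fun l => Finset.univ.filter fun ω : ∀ j, α j ≃ β j =>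
        T l ≤ ((E l).filter fun x => ω x.1 x.2 ∈ P l x).card)
    (fun l => (E l).image Sigma.fst) ?_ p g hg0 ?_ ?_ hpg).imp
    fun ω hω l => by simpa using hω l
  · intro l ω ω' h hω
    simp only [Finset.mem_filter, Finset.mem_univ, true_and] at hω ⊢
    refine hω.trans (le_of_eq ?_)
    congr 1
    refine Finset.filter_congr fun x hx => ?_
    rw [h x.1 (Finset.mem_image_of_mem _ hx)]
  · intro l
    refine (card_pi_equiv_tail_le (P l) Δ (t l) d (T l) (L l) (htd l) (htT l) hd (E l) (hE l)
      (hP l)).trans (mul_le_mul_of_nonneg_right (hp l) (Nat.cast_nonneg _))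
  · intro l
    refine le_trans (Finset.card_le_card fun l' => ?_) (hg l)
    simp only [Finset.mem_filter, Finset.mem_univ, true_and, Finset.not_disjoint_iff,
      Finset.mem_image]
    rintro ⟨j, ⟨x, hx, rfl⟩, ⟨y, hy, hxy⟩⟩
    exact ⟨x, hx, y, hy, hxy.symm⟩

end Tail

section Families

variable {ι : Type*} [Fintype ι]

/-- Directions of affine lines that are neither horizontal nor vertical, in lowest terms. -/
def IsObliqueDir (a b : ℤ) : Prop := a ≠ 0 ∧ b ≠ 0 ∧ IsCoprime a b

/-- The size of a direction. -/
def dirHeight (a b : ℤ) : ℕ := max a.natAbs b.natAbs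

/-- The number of points of the blocks `X j × Y j` on the line `b x - a y = c`. -/
def lineCount (X Y : ι → Finset ℤ) (a b c : ℤ) : ℕ :=
  ∑ j, ((X j ×ˢ Y j).filter fun p => b * p.1 - a * p.2 = c).card

/-- A family of disjoint blocks `X j × Y j` in the square `[0, n)²`, of side `D` or `D + 1`, with
multiplicities `g j ≤ G` whose sum along each row and column is `k`. -/
structure IsBlockFamily (n k D G : ℕ) (X Y : ι → Finset ℤ) (g : ι → ℕ) : Prop where
  card_eq : ∀ j, (X j).card = (Y j).card
  le_card : ∀ j, D ≤ (Y j).card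
  card_le : ∀ j, (Y j).card ≤ D + 1
  X_subset : ∀ j, X j ⊆ Finset.Ico 0 (n : ℤ)
  Y_subset : ∀ j, Y j ⊆ Finset.Ico 0 (n : ℤ)
  disj : ∀ j j' x y, x ∈ X j → x ∈ X j' → y ∈ Y j → y ∈ Y j' → j = j'
  sum_X : ∀ x ∈ Finset.Ico 0 (n : ℤ), (∑ j with x ∈ X j, g j) = k
  sum_Y : ∀ y ∈ Finset.Ico 0 (n : ℤ), (∑ j with y ∈ Y j, g j) = k
  g_le : ∀ j, g j ≤ G

theorem neighbour_bound {D : ℕ} (hD : 1000 ≤ D) :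
    4 * (1 / (D : ℝ) ^ 8) * ((20 * D * ((D + 1) ^ 2 * (4 * D ^ 4)) : ℕ) : ℝ) ≤ 1 := by
  have h : (1000 : ℝ) ≤ D := by exact_mod_cast hD
  have h0 : (0 : ℝ) < D := by linarith
  rw [mul_one_div, div_mul_eq_mul_div, div_le_one (by positivity)]
  push_cast
  have h1 : 320 * ((D : ℝ) + 1) ^ 2 ≤ D ^ 3 := by nlinarith [mul_nonneg h0.le h0.le]
  calc _ = 320 * ((D : ℝ) + 1) ^ 2 * D ^ 5 := by ring
    _ ≤ D ^ 3 * D ^ 5 := by gcongr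
    _ = _ := by ring

open scoped Classical in
/-- One can choose bijections of rows with columns within the blocks such that every line of
moderate height meets few of the pairs selected by the relations `R j`. -/
theorem exists_bijOn_forall_line_lt {n k D G : ℕ} {X Y : ι → Finset ℤ} {g : ι → ℕ}
    (hF : IsBlockFamily n k D G X Y g) (hD : 1000 ≤ D) (R : ι → ℤ → ℤ → Prop) (Δ : ℕ)
    (hR : ∀ j, ∀ y ∈ Y j, ((Y j).filter fun y' => R j y' y).card ≤ Δ)
    (t T L : ℤ → ℤ → ℕ)
    (hL : ∀ a b c, IsObliqueDir a b → dirHeight a b < D ^ 2 → lineCount X Y a b c ≤ L a b)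
    (hLD : ∀ a b, IsObliqueDir a b → dirHeight a b < D ^ 2 → L a b ≤ 20 * D)
    (ht1 : ∀ a b, IsObliqueDir a b → dirHeight a b < D ^ 2 → 1 ≤ t a b)
    (htD : ∀ a b, IsObliqueDir a b → dirHeight a b < D ^ 2 → t a b < D)
    (htT : ∀ a b, IsObliqueDir a b → dirHeight a b < D ^ 2 → t a b ≤ T a b)
    (hp : ∀ a b, IsObliqueDir a b → dirHeight a b < D ^ 2 →
      (L a b * ((Δ : ℝ) / (D - t a b)) / (T a b + 1 - t a b)) ^ (t a b) ≤ 1 / (D : ℝ) ^ 8) :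
    ∃ w : ι → ℤ → ℤ, (∀ j, BijOn (w j) (X j) (Y j)) ∧
      ∀ a b c, IsObliqueDir a b → dirHeight a b < D ^ 2 →
        (∑ j, ((X j ×ˢ Y j).filter fun p =>
          b * p.1 - a * p.2 = c ∧ R j (w j p.1) p.2).card) < T a b := by
  let dirs : Finset (ℤ × ℤ) :=
    Finset.Ioo (-(D : ℤ) ^ 2) ((D : ℤ) ^ 2) ×ˢ Finset.Ioo (-(D : ℤ) ^ 2) ((D : ℤ) ^ 2)
  have hdirs : dirs.card ≤ 4 * D ^ 4 := by
    have : (Finset.Ioo (-(D : ℤ) ^ 2) ((D : ℤ) ^ 2)).card ≤ 2 * D ^ 2 := by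
      rw [Int.card_Ioo]
      have : ((D ^ 2 : ℕ) : ℤ) = (D : ℤ) ^ 2 := by push_cast; rfl
      omega
    calc dirs.card = _ * _ := Finset.card_product _ _
      _ ≤ (2 * D ^ 2) * (2 * D ^ 2) := Nat.mul_le_mul this this
      _ = _ := by ring
  have mem_dirs : ∀ a b, dirHeight a b < D ^ 2 → (a, b) ∈ dirs := by
    intro a b h
    have : ((D ^ 2 : ℕ) : ℤ) = (D : ℤ) ^ 2 := by push_cast; rfl
    simp only [dirHeight] at h
    simp only [dirs, Finset.mem_product, Finset.mem_Ioo]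
    omega
  let pts : ι → Finset (ℤ × ℤ) := fun j => X j ×ˢ Y j
  let lines : Finset (ℤ × ℤ × ℤ) := (Finset.univ.biUnion fun j => (pts j ×ˢ dirs).image
    fun q => (q.2.1, q.2.2, q.2.2 * q.1.1 - q.2.1 * q.1.2)).filter fun l =>
      IsObliqueDir l.1 l.2.1 ∧ dirHeight l.1 l.2.1 < D ^ 2
  have mem_lines : ∀ l : lines, IsObliqueDir l.1.1 l.1.2.1 ∧ dirHeight l.1.1 l.1.2.1 < D ^ 2 :=
    fun l => (Finset.mem_filter.1 l.2).2
  let E : lines → Finset (Σ j, X j) := fun l => Finset.univ.filter fun x =>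
    ∃ y ∈ Y x.1, l.1.2.1 * (x.2 : ℤ) - l.1.1 * y = l.1.2.2
  let P : lines → ∀ x : (Σ j, X j), Finset (Y x.1) := fun l x => Finset.univ.filter fun y' =>
    ∃ y ∈ Y x.1, l.1.2.1 * (x.2 : ℤ) - l.1.1 * y = l.1.2.2 ∧ R x.1 y' y
  have uniq : ∀ {a b c x y y' : ℤ}, a ≠ 0 → b * x - a * y = c → b * x - a * y' = c → y = y' := by
    intro a b c x y y' ha h h'
    exact mul_left_cancel₀ ha (by linarith)
  have hE : ∀ l, (E l).card ≤ L l.1.1 l.1.2.1 := by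
    intro l
    refine le_trans ?_ (hL _ _ l.1.2.2 (mem_lines l).1 (mem_lines l).2)
    unfold lineCount
    rw [← Finset.card_sigma]
    choose! f hf1 hf2 using fun x (hx : x ∈ E l) => (Finset.mem_filter.1 hx).2
    refine Finset.card_le_card_of_injOn (fun x => ⟨x.1, ((x.2 : ℤ), f x)⟩) ?_ ?_
    · intro x hx
      simp only [Finset.coe_sigma, Set.mem_sigma_iff, Finset.mem_coe, Finset.mem_univ, true_and,
        Finset.mem_filter, Finset.mem_product]
      exact ⟨⟨x.2.2, hf1 x hx⟩, hf2 x hx⟩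
    · rintro ⟨j, x⟩ _ ⟨j', x'⟩ _ h
      simp only [Sigma.mk.injEq] at h
      obtain ⟨rfl, h⟩ := h
      simp only [heq_eq_eq, Prod.mk.injEq] at h
      have := Subtype.ext h.1
      rw [this]
  have hP : ∀ l, ∀ x ∈ E l, (P l x).card ≤ Δ := by
    intro l x hx
    obtain ⟨y, hy, hxy⟩ := (Finset.mem_filter.1 hx).2
    refine le_trans ?_ (hR x.1 y hy)
    refine Finset.card_le_card_of_injOn (fun y' => (y' : ℤ)) ?_ Subtype.val_injective.injOn
    intro y' hy'
    obtain ⟨y₁, hy₁, h1, h2⟩ := (Finset.mem_filter.1 hy').2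
    rw [uniq (mem_lines l).1.1 h1 hxy] at h2
    exact Finset.mem_coe.2 (Finset.mem_filter.2 ⟨y'.2, h2⟩)
  have hg : ∀ l, (Finset.univ.filter fun l' => ∃ x ∈ E l, ∃ y ∈ E l', x.1 = y.1).card ≤
      20 * D * ((D + 1) ^ 2 * (4 * D ^ 4)) := by
    intro l
    rw [← Finset.card_map (Function.Embedding.subtype (· ∈ lines))]
    refine le_trans (Finset.card_le_card (t := (E l).biUnion fun x =>
      (pts x.1 ×ˢ dirs).image fun q => (q.2.1, q.2.2, q.2.2 * q.1.1 - q.2.1 * q.1.2)) ?_) ?_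
    · intro l₁ hl₁
      simp only [Finset.mem_map, Finset.mem_filter, Finset.mem_univ, true_and,
        Function.Embedding.subtype_apply] at hl₁
      obtain ⟨l', ⟨x, hx, y, hy, hxy⟩, rfl⟩ := hl₁
      obtain ⟨v, hv, hyv⟩ := (Finset.mem_filter.1 hy).2
      refine Finset.mem_biUnion.2 ⟨x, hx, Finset.mem_image.2
        ⟨(((y.2 : ℤ), v), (l'.1.1, l'.1.2.1)), Finset.mem_product.2 ⟨?_, ?_⟩, ?_⟩⟩
      · simp only [pts, hxy, Finset.mem_product]
        exact ⟨y.2.2, hv⟩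
      · exact mem_dirs _ _ (mem_lines l').2
      · simp only [hyv]
    · refine (Finset.card_biUnion_le_card_mul _ _ ((D + 1) ^ 2 * (4 * D ^ 4)) fun x _ => ?_).trans
        (Nat.mul_le_mul_right _ ((hE l).trans (hLD _ _ (mem_lines l).1 (mem_lines l).2)))
      refine Finset.card_image_le.trans ?_
      rw [Finset.card_product, Finset.card_product, hF.card_eq, ← sq]
      exact Nat.mul_le_mul (Nat.pow_le_pow_left (hF.card_le _) 2) hdirs
  have hone : 1 ≤ 20 * D * ((D + 1) ^ 2 * (4 * D ^ 4)) := by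
    have : 0 < D := by omega
    exact Nat.succ_le_of_lt (by positivity)
  have : ∀ j, Nonempty (X j ≃ Y j) := fun j => ⟨Finset.equivOfCardEq (hF.card_eq j)⟩
  obtain ⟨ω, hω⟩ := exists_equiv_forall_card_lt (α := fun j => X j) (β := fun j => Y j) E P Δ D (fun l => t l.1.1 l.1.2.1)
    (fun l => T l.1.1 l.1.2.1) (fun l => L l.1.1 l.1.2.1)
    (fun j => by rw [Fintype.card_coe, hF.card_eq]; exact hF.le_card j)
    (fun l => htD _ _ (mem_lines l).1 (mem_lines l).2)
    (fun l => htT _ _ (mem_lines l).1 (mem_lines l).2) hE hP (1 / (D : ℝ) ^ 8)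
    (20 * D * ((D + 1) ^ 2 * (4 * D ^ 4))) hone (fun l => by convert hg l)
    (fun l => hp _ _ (mem_lines l).1 (mem_lines l).2) (neighbour_bound hD)
  let w : ι → ℤ → ℤ := fun j x => if h : x ∈ X j then ω j ⟨x, h⟩ else 0
  have hw : ∀ j x (h : x ∈ X j), w j x = ω j ⟨x, h⟩ := fun j x h => dif_pos h
  refine ⟨w, fun j => ⟨fun x hx => ?_, fun x hx x' hx' h => ?_, fun y hy => ?_⟩, ?_⟩
  · rw [hw j x hx]; exact (ω j _).2
  · rw [hw j x hx, hw j x' hx'] at h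
    simpa using (ω j).injective (Subtype.ext h)
  · refine ⟨(ω j).symm ⟨y, hy⟩, ((ω j).symm ⟨y, hy⟩).2, ?_⟩
    rw [hw j _ ((ω j).symm ⟨y, hy⟩).2]
    simp
  · intro a b c hab hht
    by_cases hl : (a, b, c) ∈ lines
    · refine lt_of_le_of_lt ?_ (hω ⟨(a, b, c), hl⟩)
      rw [← Finset.card_sigma]
      refine Finset.card_le_card_of_surjOn (fun x => ⟨x.1, ((x.2 : ℤ), (b * x.2 - c) / a)⟩) ?_
      rintro ⟨j, x, y⟩ h
      simp only [Finset.coe_sigma, Set.mem_sigma_iff, Finset.mem_coe, Finset.mem_univ, true_and,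
        Finset.mem_filter, Finset.mem_product] at h
      obtain ⟨⟨hx, hy⟩, h1, h2⟩ := h
      rw [hw j x hx] at h2
      refine ⟨⟨j, ⟨x, hx⟩⟩, ?_, ?_⟩
      · simp only [Finset.coe_filter, Set.mem_ofPred_eq, E, P, Finset.mem_filter, Finset.mem_univ,
          true_and]
        exact ⟨⟨y, hy, h1⟩, ⟨y, hy, h1, h2⟩⟩
      · have : (b * x - c) / a = y := by
          rw [← h1]
          rw [show b * x - (b * x - a * y) = a * y by ring]
          exact Int.mul_ediv_cancel_left _ hab.1
        simp [this]
    · rw [Finset.sum_eq_zero]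
      · exact lt_of_lt_of_le (ht1 a b hab hht) (htT a b hab hht)
      · intro j _
        rw [Finset.card_eq_zero, Finset.filter_eq_empty_iff]
        rintro ⟨x, y⟩ hxy ⟨h1, -⟩
        refine hl (Finset.mem_filter.2 ⟨Finset.mem_biUnion.2 ⟨j, Finset.mem_univ _,
          Finset.mem_image.2 ⟨((x, y), (a, b)), Finset.mem_product.2 ⟨hxy, mem_dirs a b hht⟩, ?_⟩⟩,
          hab, hht⟩)
        simp only at h1 ⊢
        rw [h1]

end Families

section StageNumerics

theorem stage_ratio_le {z D t : ℝ} (hz : 10 ^ 37 ≤ z) (hD : z ^ 128 ≤ D) (ht : t ≤ z ^ 6) :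
    (z ^ 16 + 1) / (D - t) ≤ (z ^ 16 + z) / D := by
  have hz1 : (1 : ℝ) ≤ z := by linarith
  have hz2 : (2 : ℝ) ≤ z := by linarith
  have hz0 : 0 < z := by linarith
  have h1 : z ^ 6 + 2 * z ^ 22 ≤ z ^ 128 := by
    have h6 : z ^ 6 ≤ z ^ 22 := pow_le_pow_right₀ hz1 (by norm_num)
    have h24 : z ^ 24 ≤ z ^ 128 := pow_le_pow_right₀ hz1 (by norm_num)
    have : z ^ 24 = z ^ 22 * (z * z) := by ring
    have : 3 * z ^ 22 ≤ z ^ 22 * (z * z) := by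
      rw [mul_comm (3 : ℝ)]
      gcongr
      nlinarith
    linarith
  have hp : 0 < z ^ 22 := by positivity
  have hD0 : 0 < D := by linarith [show 0 < z ^ 128 by positivity]
  rw [div_le_div_iff₀ (by linarith) hD0]
  have h2 : (z ^ 16 + z) * t ≤ 2 * z ^ 22 := by
    have h16 : z ≤ z ^ 16 := by simpa using pow_le_pow_right₀ hz1 (show 1 ≤ 16 by norm_num)
    calc (z ^ 16 + z) * t ≤ (z ^ 16 + z) * z ^ 6 := by gcongr
      _ ≤ (z ^ 16 + z ^ 16) * z ^ 6 := by gcongr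
      _ = 2 * z ^ 22 := by ring
  have h3 : D ≤ (z - 1) * D := le_mul_of_one_le_left hD0.le (by linarith)
  have h6 : 0 < z ^ 6 := by positivity
  linarith

theorem stage_main_le {z B U : ℝ} (hz : 10 ^ 37 ≤ z) (hB : 0 ≤ B)
    (hU : (1 + 1 / z) * z ^ 16 * B + z ^ 8 - z ^ 6 ≤ U) :
    ((1 + 1 / (4 * z)) * B + 1 / z ^ 60) * (z ^ 16 + z) / U ≤ 1 - 1 / (4 * z) := by
  have hz0 : 0 < z := by linarith
  have hz1 : (1 : ℝ) ≤ z := by linarith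
  obtain ⟨e, he⟩ : ∃ e, e = 1 / z := ⟨_, rfl⟩
  have hze : z * e = 1 := by rw [he]; field_simp
  have he0 : 0 < e := by rw [he]; positivity
  have he1 : e ≤ 1 := by nlinarith
  have h4 : 1 / (4 * z) = e / 4 := by rw [he]; field_simp
  have h60 : 1 / z ^ 60 = e ^ 60 := by rw [he]; simp
  rw [h4, h60]
  rw [← he] at hU
  have h8 : 2 ≤ z ^ 8 - z ^ 6 := by
    have h6 : 1 ≤ z ^ 6 := one_le_pow₀ hz1
    have : z ^ 8 - z ^ 6 = z ^ 6 * (z * z - 1) := by ring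
    rw [this]
    calc (2 : ℝ) = 1 * 2 := by norm_num
      _ ≤ z ^ 6 * (z * z - 1) := by
        gcongr
        have h2 : (2 : ℝ) ≤ z := by linarith
        nlinarith
  have hU0 : 0 < U := by
    have : 0 ≤ (1 + e) * z ^ 16 * B := by positivity
    linarith
  rw [div_le_iff₀ hU0]
  have h16 : z ^ 16 * e = z ^ 15 := by rw [show z ^ 16 * e = z ^ 15 * (z * e) by ring, hze, mul_one]
  have h15 : z ^ 15 * e = z ^ 14 := by rw [show z ^ 15 * e = z ^ 14 * (z * e) by ring, hze, mul_one]
  have hc : (1 + e / 4) * (z ^ 16 + z) ≤ (1 - e / 4) * ((1 + e) * z ^ 16) := by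
    have h14 : z ^ 15 = z * z ^ 14 := by ring
    have h13 : z * 1 ≤ z * z ^ 13 := by
      gcongr
      exact one_le_pow₀ hz1
    have h13' : z * z ^ 13 = z ^ 14 := by ring
    have h14p : 0 < z ^ 14 := by positivity
    have e1 : (1 - e / 4) * ((1 + e) * z ^ 16) - (1 + e / 4) * (z ^ 16 + z) =
      (z ^ 16 * e) / 2 - (z ^ 16 * e) * e / 4 - z - (z * e) / 4 := by ring
    rw [h16, h15, hze] at e1
    nlinarith
  have h1 : e ^ 60 * (z ^ 16 + z) ≤ 1 := by
    have ha : z ^ 16 + z ≤ z ^ 60 := by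
      have : z ≤ z ^ 16 := by simpa using pow_le_pow_right₀ hz1 (show 1 ≤ 16 by norm_num)
      have h17 : z ^ 17 ≤ z ^ 60 := pow_le_pow_right₀ hz1 (by norm_num)
      have : z ^ 17 = z * z ^ 16 := by ring
      have : 0 < z ^ 16 := by positivity
      nlinarith
    calc e ^ 60 * (z ^ 16 + z) ≤ e ^ 60 * z ^ 60 := by gcongr
      _ = (z * e) ^ 60 := by ring
      _ = 1 := by rw [hze]; simp
  have h2 : (1 - e / 4) * ((1 + e) * z ^ 16 * B + z ^ 8 - z ^ 6) ≤ (1 - e / 4) * U := by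
    gcongr
    linarith
  have h3 : (1 : ℝ) ≤ (1 - e / 4) * (z ^ 8 - z ^ 6) := by nlinarith
  have h5 := mul_le_mul_of_nonneg_right hc hB
  linarith

theorem stage_pow_le {z D : ℝ} (hz : 10 ^ 37 ≤ z) (hD0 : 0 < D) (hD : D ≤ (z + 1) ^ 128) (m : ℕ)
    (hm : z ^ 6 ≤ m) : (1 - 1 / (4 * z)) ^ m ≤ 1 / D ^ 8 := by
  have hz0 : 0 < z := by linarith
  have h1 : 1 - 1 / (4 * z) ≤ Real.exp (-(1 / (4 * z))) := by
    have := Real.add_one_le_exp (-(1 / (4 * z)))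
    linarith
  have h0 : 0 ≤ 1 - 1 / (4 * z) := by
    rw [sub_nonneg, div_le_one (by positivity)]
    linarith
  have h2 : D ^ 8 ≤ Real.exp (1024 * z) := by
    calc D ^ 8 ≤ ((z + 1) ^ 128) ^ 8 := by gcongr
      _ = (z + 1) ^ 1024 := by rw [← pow_mul]
      _ ≤ (Real.exp z) ^ 1024 := by
        gcongr
        exact Real.add_one_le_exp z
      _ = _ := by rw [← Real.exp_nat_mul]; norm_num
  calc (1 - 1 / (4 * z)) ^ m ≤ (Real.exp (-(1 / (4 * z)))) ^ m := by gcongr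
    _ = Real.exp (-(m / (4 * z))) := by rw [← Real.exp_nat_mul]; congr 1; ring
    _ ≤ Real.exp (-(1024 * z)) := by
      apply Real.exp_le_exp.2
      rw [neg_le_neg_iff, le_div_iff₀ (by positivity)]
      have h4 : (4096 : ℝ) * z ^ 2 ≤ z ^ 4 * z ^ 2 := by
        gcongr
        calc (4096 : ℝ) ≤ 10 ^ 37 := by norm_num
          _ ≤ z := hz
          _ ≤ z ^ 4 := by simpa using pow_le_pow_right₀ (by linarith : 1 ≤ z) (show 1 ≤ 4 by norm_num)
      nlinarith
    _ = 1 / Real.exp (1024 * z) := by rw [Real.exp_neg, one_div]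
    _ ≤ _ := by gcongr

set_option exponentiation.threshold 2000 in
theorem stage_high_le {z D B : ℝ} (hz : 10 ^ 37 ≤ z) (hD0 : 0 < D) (hD : D ≤ (z + 1) ^ 128)
    (hB0 : 0 ≤ B) (hB : B ≤ 8 / z ^ 32) :
    (((1 + 1 / (4 * z)) * B + 1 / z ^ 60) * (z ^ 16 + z) / 2) ^ 70 ≤ 1 / D ^ 8 := by
  have hz0 : 0 < z := by linarith
  have hz1 : (1 : ℝ) ≤ z := by linarith
  have h1 : 1 / (4 * z) ≤ 1 := by
    rw [div_le_one (by positivity)]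
    linarith
  have h2 : 1 / z ^ 60 ≤ 1 / z ^ 32 :=
    one_div_le_one_div_of_le (by positivity) (pow_le_pow_right₀ hz1 (by norm_num))
  have h3 : z ≤ z ^ 16 := by simpa using pow_le_pow_right₀ hz1 (show 1 ≤ 16 by norm_num)
  have h4 : ((1 + 1 / (4 * z)) * B + 1 / z ^ 60) * (z ^ 16 + z) / 2 ≤ 17 / z ^ 16 := by
    calc _ ≤ ((1 + 1) * (8 / z ^ 32) + 1 / z ^ 32) * (z ^ 16 + z ^ 16) / 2 := by gcongr
      _ = 17 / z ^ 16 := by field_simp; norm_num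
  calc _ ≤ (17 / z ^ 16) ^ 70 := by gcongr
    _ = 17 ^ 70 / z ^ 1120 := by rw [div_pow, ← pow_mul]
    _ ≤ 1 / D ^ 8 := by
      rw [div_le_div_iff₀ (by positivity) (by positivity), one_mul]
      calc 17 ^ 70 * D ^ 8 ≤ 17 ^ 70 * ((z + 1) ^ 128) ^ 8 := by gcongr
        _ ≤ 17 ^ 70 * ((z + z) ^ 128) ^ 8 := by gcongr
        _ = (17 ^ 70 * 2 ^ 1024) * z ^ 1024 := by
          rw [← two_mul, ← pow_mul, mul_pow]; ring
        _ ≤ (10 ^ 37 : ℝ) ^ 96 * z ^ 1024 := by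
          gcongr
          norm_num
        _ ≤ z ^ 96 * z ^ 1024 := by gcongr
        _ = z ^ 1120 := by rw [← pow_add]

end StageNumerics

section Refinement

theorem exists_equitable_colouring (Y : Finset ℤ) (s D : ℕ) (hs : 0 < s) (h1 : s * D ≤ Y.card)
    (h2 : Y.card ≤ s * (D + 1)) :
    ∃ col : ℤ → Fin s, ∀ i, D ≤ (Y.filter fun y => col y = i).card ∧
      (Y.filter fun y => col y = i).card ≤ D + 1 := by
  have : NeZero s := ⟨hs.ne'⟩
  refine ⟨fun y => if h : y ∈ Y then ⟨Y.equivFin ⟨y, h⟩ % s, Nat.mod_lt _ hs⟩ else 0, fun i => ?_⟩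
  have hcard : (Y.filter fun y => (if h : y ∈ Y then
      (⟨Y.equivFin ⟨y, h⟩ % s, Nat.mod_lt _ hs⟩ : Fin s) else 0) = i).card =
      Y.card / s + if i.1 < Y.card % s then 1 else 0 := by
    have h3 := Nat.count_modEq_card Y.card hs i.1
    rw [Nat.mod_eq_of_lt i.2] at h3
    rw [← h3, Nat.count_eq_card_filter_range]
    refine Finset.card_bij' (fun y hy => (Y.equivFin ⟨y, (Finset.mem_filter.1 hy).1⟩ : ℕ))
      (fun v hv => (Y.equivFin.symm ⟨v, Finset.mem_range.1 (Finset.mem_filter.1 hv).1⟩ : ℤ))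
      ?_ ?_ ?_ ?_
    · intro y hy
      obtain ⟨hy1, hy2⟩ := Finset.mem_filter.1 hy
      rw [dif_pos hy1] at hy2
      simp only [Finset.mem_filter, Finset.mem_range, Fin.is_lt, true_and]
      rw [Nat.ModEq, Nat.mod_eq_of_lt i.2]
      exact congrArg Fin.val hy2
    · intro v hv
      obtain ⟨hv1, hv2⟩ := Finset.mem_filter.1 hv
      rw [Nat.ModEq, Nat.mod_eq_of_lt i.2] at hv2
      refine Finset.mem_filter.2 ⟨(Y.equivFin.symm _).2, ?_⟩
      rw [dif_pos (Y.equivFin.symm _).2]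
      ext
      simp [hv2]
    · intro y hy
      simp
    · intro v hv
      simp
  rw [hcard]
  have h3 : D ≤ Y.card / s := (Nat.le_div_iff_mul_le hs).2 (by linarith)
  refine ⟨by omega, ?_⟩
  have h4 : Y.card / s ≤ D + 1 := Nat.div_le_of_le_mul h2
  rcases h4.lt_or_eq with h5 | h5
  · split_ifs <;> omega
  · have h6 := Nat.div_add_mod Y.card s
    rw [h5] at h6
    have : Y.card % s = 0 := by omega
    simp [this, h5]

variable {ι : Type*} [Fintype ι]

/-- Splitting each block along a colouring of its columns and the pullback of this colouring to
its rows by a bijection. -/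
theorem IsBlockFamily.refine {n k D G : ℕ} {X Y : ι → Finset ℤ} {g : ι → ℕ}
    (hF : IsBlockFamily n k D G X Y g) {s D' : ℕ} (w : ι → ℤ → ℤ)
    (hw : ∀ j, BijOn (w j) (X j) (Y j)) (col : ι → ℤ → Fin s)
    (hcol : ∀ j i, D' ≤ ((Y j).filter fun y => col j y = i).card ∧
      ((Y j).filter fun y => col j y = i).card ≤ D' + 1) :
    IsBlockFamily n k D' G
      (fun q : ι × Fin s => (X q.1).filter fun x => col q.1 (w q.1 x) = q.2)
      (fun q : ι × Fin s => (Y q.1).filter fun y => col q.1 y = q.2) (fun q => g q.1) where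
  card_eq q := by
    refine Finset.card_bij (fun x _ => w q.1 x) ?_ ?_ ?_
    · intro x hx
      obtain ⟨h1, h2⟩ := Finset.mem_filter.1 hx
      exact Finset.mem_filter.2 ⟨(hw q.1).mapsTo h1, h2⟩
    · intro x hx x' hx' h
      exact (hw q.1).injOn (Finset.mem_filter.1 hx).1 (Finset.mem_filter.1 hx').1 h
    · intro y hy
      obtain ⟨h1, h2⟩ := Finset.mem_filter.1 hy
      obtain ⟨x, hx, rfl⟩ := (hw q.1).surjOn h1
      exact ⟨x, Finset.mem_filter.2 ⟨hx, h2⟩, rfl⟩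
  le_card q := (hcol q.1 q.2).1
  card_le q := (hcol q.1 q.2).2
  X_subset q := (Finset.filter_subset _ _).trans (hF.X_subset q.1)
  Y_subset q := (Finset.filter_subset _ _).trans (hF.Y_subset q.1)
  disj := by
    rintro ⟨j, i⟩ ⟨j', i'⟩ x y h1 h2 h3 h4
    simp only [Finset.mem_filter] at h1 h2 h3 h4
    obtain rfl := hF.disj j j' x y h1.1 h2.1 h3.1 h4.1
    rw [← h1.2, ← h2.2]
  sum_X x hx := by
    rw [← hF.sum_X x hx, Finset.sum_filter, Finset.sum_filter, Fintype.sum_prod_type]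
    refine Finset.sum_congr rfl fun j _ => ?_
    by_cases h : x ∈ X j <;> simp [h]
  sum_Y y hy := by
    rw [← hF.sum_Y y hy, Finset.sum_filter, Finset.sum_filter, Fintype.sum_prod_type]
    refine Finset.sum_congr rfl fun j _ => ?_
    by_cases h : y ∈ Y j <;> simp [h]
  g_le q := hF.g_le q.1

theorem lineCount_refine (X Y : ι → Finset ℤ) {s : ℕ} (w : ι → ℤ → ℤ) (col : ι → ℤ → Fin s)
    (a b c : ℤ) :
    lineCount (fun q : ι × Fin s => (X q.1).filter fun x => col q.1 (w q.1 x) = q.2)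
      (fun q : ι × Fin s => (Y q.1).filter fun y => col q.1 y = q.2) a b c =
    ∑ j, ((X j ×ˢ Y j).filter fun p =>
      b * p.1 - a * p.2 = c ∧ col j (w j p.1) = col j p.2).card := by
  unfold lineCount
  rw [Fintype.sum_prod_type]
  refine Finset.sum_congr rfl fun j _ => ?_
  rw [Finset.card_eq_sum_card_fiberwise (f := fun p => col j p.2) (t := Finset.univ)
    (fun _ _ => Finset.mem_univ _)]
  refine Finset.sum_congr rfl fun i _ => ?_
  congr 1
  ext ⟨x, y⟩
  simp only [Finset.mem_filter, Finset.mem_product]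
  constructor
  · rintro ⟨⟨⟨h1, h2⟩, h3, h4⟩, h5⟩
    exact ⟨⟨⟨h1, h3⟩, h5, h2.trans h4.symm⟩, h4⟩
  · rintro ⟨⟨⟨h1, h3⟩, h5, h2⟩, h4⟩
    exact ⟨⟨⟨h1, h2.trans h4⟩, h3, h4⟩, h5⟩

/-- Bounds for the number of points of a family of blocks on oblique lines, with an absolute
bound for the lines of height at least `H`. -/
def HasLineBounds (X Y : ι → Finset ℤ) (β : ℕ → ℝ) (H : ℕ) (U V : ℝ) : Prop :=
  ∀ a b c, IsObliqueDir a b → (lineCount X Y a b c : ℝ) ≤ U * β (dirHeight a b) + V ∧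
    (H ≤ dirHeight a b → lineCount X Y a b c ≤ 70)

/-- A family of scale `D ≈ z ^ 128` may be refined to a family of scale `z ^ 16`. -/
theorem exists_refinement {ι : Type} [Fintype ι] {n k D G z : ℕ} {X Y : ι → Finset ℤ} {g : ι → ℕ}
    (hF : IsBlockFamily n k D G X Y g) (β : ℕ → ℝ) (hβ0 : ∀ M, 0 ≤ β M) (hβ8 : ∀ M, β M ≤ 8)
    (hβM : ∀ M, β M * M ≤ 8) (hz : 10 ^ 37 ≤ z) (hD1 : z ^ 128 ≤ D) (hD2 : D < (z + 1) ^ 128)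
    (hL : HasLineBounds X Y β (D ^ 2) ((1 + 1 / (4 * (z : ℝ))) * D) (D / (z : ℝ) ^ 60)) :
    ∃ (ι' : Type) (_ : Fintype ι') (X' Y' : ι' → Finset ℤ) (g' : ι' → ℕ),
      IsBlockFamily n k (z ^ 16) G X' Y' g' ∧
      HasLineBounds X' Y' β ((z ^ 16) ^ 2) ((1 + 1 / (z : ℝ)) * (z : ℝ) ^ 16) ((z : ℝ) ^ 8) := by
  classical
  have hzR : (10 : ℝ) ^ 37 ≤ z := by exact_mod_cast hz
  have hz0 : (0 : ℝ) < z := by linarith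
  have hz1 : (1 : ℝ) ≤ z := by linarith
  have hzp : 0 < z := by exact_mod_cast hz0
  have hD1R : (z : ℝ) ^ 128 ≤ D := by exact_mod_cast hD1
  have hD2R : (D : ℝ) ≤ ((z : ℝ) + 1) ^ 128 := by exact_mod_cast hD2.le
  have hD0 : (0 : ℝ) < D := lt_of_lt_of_le (pow_pos hz0 _) hD1R
  have h32 : z ^ 32 ≤ D := le_trans (Nat.pow_le_pow_right hzp (by norm_num)) hD1
  have h16p : 0 < z ^ 16 := Nat.pow_pos hzp
  have hz1000 : 1000 ≤ z := le_trans (by norm_num) hz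
  have h7D : z ^ 7 ≤ D := le_trans (Nat.pow_le_pow_right hzp (by norm_num)) hD1
  clear hz hD1 hD2
  set s := D / z ^ 16 with hs
  have hs1 : z ^ 16 ≤ s := by
    rw [hs, Nat.le_div_iff_mul_le h16p, ← pow_add]
    exact h32
  have hs0 : 0 < s := lt_of_lt_of_le h16p hs1
  have hs2 : s * z ^ 16 ≤ D := Nat.div_mul_le_self _ _
  have hs3 : D + 1 ≤ s * (z ^ 16 + 1) := by
    have h1 := Nat.div_add_mod D (z ^ 16)
    have h2 := Nat.mod_lt D h16p
    rw [← hs, mul_comm] at h1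
    rw [mul_add]
    omega
  choose col hcol using fun j => exists_equitable_colouring (Y j) s (z ^ 16) hs0
    (hs2.trans (hF.le_card j)) ((hF.card_le j).trans hs3)
  have h6D : z ^ 6 < D := lt_of_lt_of_le
    (Nat.pow_lt_pow_right (by omega) (by norm_num)) h7D
  have hzD : z ≤ D := le_trans (by simpa using Nat.pow_le_pow_right hzp (show 1 ≤ 7 by norm_num)) h7D
  have hD1000 : 1000 ≤ D := hz1000.trans hzD
  have h70 : 70 < D := lt_of_lt_of_le (by norm_num) hD1000
  have h4z : 1 / (4 * (z : ℝ)) ≤ 1 := by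
    rw [div_le_one (by positivity)]
    linarith
  have h60 : (D : ℝ) / (z : ℝ) ^ 60 ≤ D := div_le_self hD0.le (one_le_pow₀ hz1)
  let A : ℕ → ℝ := fun M => (1 + 1 / (4 * (z : ℝ))) * D * β M + D / (z : ℝ) ^ 60
  let W : ℕ → ℝ := fun M => (1 + 1 / (z : ℝ)) * (z : ℝ) ^ 16 * β M + (z : ℝ) ^ 8
  have hA0 : ∀ M, 0 ≤ A M := fun M => by
    have := hβ0 M
    positivity
  have hW0 : ∀ M, (z : ℝ) ^ 8 ≤ W M := fun M => by
    have := hβ0 M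
    have : 0 ≤ (1 + 1 / (z : ℝ)) * (z : ℝ) ^ 16 * β M := by positivity
    simp only [W]
    linarith
  let H := z ^ 32
  let L : ℤ → ℤ → ℕ := fun a b => ⌊A (dirHeight a b)⌋₊
  let t : ℤ → ℤ → ℕ := fun a b => if dirHeight a b < H then z ^ 6 else 70
  let T : ℤ → ℤ → ℕ := fun a b => if dirHeight a b < H then ⌊W (dirHeight a b)⌋₊ + 1 else 71
  have hquot : ∀ a b, ∀ m : ℕ, m ≤ z ^ 6 →
      (L a b : ℝ) * (((z ^ 16 + 1 : ℕ) : ℝ) / (D - m)) ≤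
      ((1 + 1 / (4 * (z : ℝ))) * β (dirHeight a b) + 1 / (z : ℝ) ^ 60) * ((z : ℝ) ^ 16 + z) := by
    intro a b m hm
    have h1 := stage_ratio_le (t := m) hzR hD1R (by exact_mod_cast hm)
    have h2 : (L a b : ℝ) ≤ A (dirHeight a b) := Nat.floor_le (hA0 _)
    push_cast
    calc (L a b : ℝ) * (((z : ℝ) ^ 16 + 1) / (D - m))
        ≤ L a b * (((z : ℝ) ^ 16 + z) / D) := by gcongr
      _ ≤ A (dirHeight a b) * (((z : ℝ) ^ 16 + z) / D) := by gcongr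
      _ = _ := by
        simp only [A]
        field_simp
  refine (exists_bijOn_forall_line_lt hF hD1000
    (fun j y' y => col j y' = col j y) (z ^ 16 + 1) (fun j y _ => by convert (hcol j (col j y)).2) t T L
    ?_ ?_ ?_ ?_ ?_ ?_).elim ?_
  · intro a b c hab _
    exact Nat.le_floor (hL a b c hab).1
  · intro a b _ _
    have : A (dirHeight a b) ≤ ((20 * D : ℕ) : ℝ) := by
      have h1 := hβ8 (dirHeight a b)
      have h0 := hβ0 (dirHeight a b)
      simp only [A]
      calc _ ≤ (1 + 1) * D * 8 + (D : ℝ) := by gcongr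
        _ ≤ ((20 * D : ℕ) : ℝ) := by push_cast; linarith
    exact Nat.floor_le_of_le this
  · intro a b _ _
    simp only [t]
    split_ifs
    · exact Nat.one_le_pow _ _ hzp
    · norm_num
  · intro a b _ _
    simp only [t]
    split_ifs
    · exact h6D
    · exact h70
  · intro a b _ _
    simp only [t, T]
    split_ifs
    · refine (Nat.le_floor ?_).trans (Nat.le_succ _)
      refine le_trans ?_ (hW0 _)
      push_cast
      exact pow_le_pow_right₀ hz1 (by norm_num)
    · norm_num
  · intro a b _ _
    simp only [t, T]
    split_ifs with h
    · have hfl := Nat.lt_floor_add_one (W (dirHeight a b))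
      have h1 := stage_main_le (U := ((⌊W (dirHeight a b)⌋₊ + 1 : ℕ) : ℝ) + 1 - ((z ^ 6 : ℕ) : ℝ))
        hzR (hβ0 (dirHeight a b)) (by
          push_cast
          simp only [W] at hfl ⊢
          linarith)
      have hden : 0 < ((⌊W (dirHeight a b)⌋₊ + 1 : ℕ) : ℝ) + 1 - ((z ^ 6 : ℕ) : ℝ) := by
        have h68 : (z : ℝ) ^ 6 ≤ (z : ℝ) ^ 8 := pow_le_pow_right₀ hz1 (by norm_num)
        have := hW0 (dirHeight a b)
        push_cast
        linarith
      refine le_trans (pow_le_pow_left₀ ?_ ?_ _) (stage_pow_le hzR hD0 hD2R (z ^ 6) (by push_cast; rfl))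
      · exact div_nonneg (mul_nonneg (Nat.cast_nonneg _) (div_nonneg (Nat.cast_nonneg _)
          (sub_nonneg.2 (by exact_mod_cast h6D.le)))) hden.le
      · refine le_trans ?_ h1
        exact div_le_div_of_nonneg_right (hquot a b _ le_rfl) hden.le
    · have hM : z ^ 32 ≤ dirHeight a b := not_lt.1 h
      have hMR : (z : ℝ) ^ 32 ≤ dirHeight a b := by exact_mod_cast hM
      have hB : β (dirHeight a b) ≤ 8 / (z : ℝ) ^ 32 := by
        rw [le_div_iff₀ (by positivity)]
        exact le_trans (mul_le_mul_of_nonneg_left hMR (hβ0 _)) (hβM _)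
      refine le_trans (pow_le_pow_left₀ ?_ ?_ _) (stage_high_le hzR hD0 hD2R (hβ0 _) hB)
      · exact div_nonneg (mul_nonneg (Nat.cast_nonneg _) (div_nonneg (Nat.cast_nonneg _)
          (sub_nonneg.2 (by exact_mod_cast h70.le)))) (by norm_num)
      · have h1 := hquot a b 70 (le_trans (show 70 ≤ z by omega)
          (by simpa using Nat.pow_le_pow_right hzp (show 1 ≤ 6 by norm_num)))
        rw [show (((71 : ℕ) : ℝ) + 1 - ((70 : ℕ) : ℝ)) = 2 by norm_num]
        exact div_le_div_of_nonneg_right h1 (by norm_num)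
  · rintro w ⟨hw, hline⟩
    refine ⟨ι × Fin s, inferInstance, _, _, _, hF.refine w hw col hcol, fun a b c hab => ?_⟩
    rw [lineCount_refine]
    have hmono : ∑ j, ((X j ×ˢ Y j).filter fun p =>
        b * p.1 - a * p.2 = c ∧ col j (w j p.1) = col j p.2).card ≤ lineCount X Y a b c :=
      Finset.sum_le_sum fun j _ => Finset.card_le_card fun p hp =>
        Finset.mem_filter.2 ⟨(Finset.mem_filter.1 hp).1, (Finset.mem_filter.1 hp).2.1⟩
    have hz8 : (70 : ℝ) ≤ (z : ℝ) ^ 8 := by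
      calc (70 : ℝ) ≤ 10 ^ 37 := by norm_num
        _ ≤ z := hzR
        _ ≤ (z : ℝ) ^ 8 := by simpa using pow_le_pow_right₀ hz1 (show 1 ≤ 8 by norm_num)
    have hlow : ∀ r : ℕ, r ≤ 70 → (r : ℝ) ≤ W (dirHeight a b) := fun r hr =>
      le_trans (by exact_mod_cast hr) (hz8.trans (hW0 _))
    have hHeq : (z ^ 16) ^ 2 = H := by simp only [H]; rw [← pow_mul]
    rw [hHeq]
    rcases lt_or_ge (dirHeight a b) (D ^ 2) with hM | hM
    · have h1 := hline a b c hab hM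
      simp only [T] at h1
      split_ifs at h1 with h2
      · refine ⟨?_, fun h3 => absurd h2 (not_lt.2 h3)⟩
        exact (Nat.le_floor_iff (le_trans (by positivity) (hW0 _))).1
          (Nat.le_of_lt_succ (by convert h1))
      · have h3 : ∑ j, ((X j ×ˢ Y j).filter fun p =>
          b * p.1 - a * p.2 = c ∧ col j (w j p.1) = col j p.2).card ≤ 70 :=
          Nat.le_of_lt_succ (by convert h1)
        exact ⟨hlow _ h3, fun _ => h3⟩
    · have h3 := hmono.trans ((hL a b c hab).2 hM)
      exact ⟨hlow _ h3, fun _ => h3⟩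

end Refinement

section Descent

theorem exists_pow_le_lt_succ_pow (m : ℕ) {p : ℕ} (hp : p ≠ 0) :
    ∃ z : ℕ, z ^ p ≤ m ∧ m < (z + 1) ^ p := by
  classical
  have hex : ∃ z : ℕ, m < (z + 1) ^ p :=
    ⟨m, lt_of_lt_of_le (Nat.lt_succ_self m) (Nat.le_self_pow hp _)⟩
  refine ⟨Nat.find hex, ?_, Nat.find_spec hex⟩
  rcases h : Nat.find hex with _ | z
  · simp [hp]
  · exact not_lt.1 (Nat.find_min hex (m := z) (by omega))

theorem HasLineBounds.mono {ι : Type*} [Fintype ι] {X Y : ι → Finset ℤ} {β : ℕ → ℝ}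
    (hβ : ∀ M, 0 ≤ β M) {H : ℕ} {U U' V V' : ℝ} (h : HasLineBounds X Y β H U V) (hU : U ≤ U')
    (hV : V ≤ V') : HasLineBounds X Y β H U' V' := fun a b c hab =>
  ⟨(h a b c hab).1.trans (add_le_add (mul_le_mul_of_nonneg_right hU (hβ _)) hV), (h a b c hab).2⟩

/-- Repeated refinement brings the scale of a family of blocks down to a power of `k`. -/
theorem exists_family_of_moderate_scale {ι : Type} [Fintype ι] {n k D G : ℕ}
    {X Y : ι → Finset ℤ} {g : ι → ℕ}
    (hF : IsBlockFamily n k D G X Y g) (β : ℕ → ℝ) (hβ0 : ∀ M, 0 ≤ β M) (hβ8 : ∀ M, β M ≤ 8)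
    (hβM : ∀ M, β M * M ≤ 8) (hk : 10 ^ 37 ≤ k) (hL : HasLineBounds X Y β (D ^ 2) D 1) :
    ∃ (D' : ℕ) (ι' : Type) (_ : Fintype ι') (X' Y' : ι' → Finset ℤ) (g' : ι' → ℕ),
      (D' = D ∨ k ^ 16 ≤ D') ∧ D' < (k + 1) ^ 128 ∧ IsBlockFamily n k D' G X' Y' g' ∧
      HasLineBounds X' Y' β (D' ^ 2) ((1 + 1 / (k : ℝ)) * D') (D' / (k : ℝ) + 1) := by
  have hkR : (10 : ℝ) ^ 37 ≤ k := by exact_mod_cast hk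
  have hk0 : (0 : ℝ) < k := by linarith
  have hkp : 0 < k := by exact_mod_cast hk0
  have hk1 : 1 / (k : ℝ) ≥ 0 := by positivity
  by_cases hD : D < (k + 1) ^ 128
  · refine ⟨D, ι, inferInstance, X, Y, g, Or.inl rfl, hD, hF, hL.mono hβ0 ?_ ?_⟩
    · exact le_mul_of_one_le_left (Nat.cast_nonneg _) (by linarith)
    · have : (0 : ℝ) ≤ D / k := div_nonneg (Nat.cast_nonneg _) hk0.le
      linarith
  have key : ∀ z : ℕ, k ≤ z → (∃ (ι' : Type) (_ : Fintype ι') (X' Y' : ι' → Finset ℤ)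
      (g' : ι' → ℕ), IsBlockFamily n k (z ^ 16) G X' Y' g' ∧
      HasLineBounds X' Y' β ((z ^ 16) ^ 2) ((1 + 1 / (z : ℝ)) * (z : ℝ) ^ 16) ((z : ℝ) ^ 8)) →
      ∃ (D' : ℕ) (ι' : Type) (_ : Fintype ι') (X' Y' : ι' → Finset ℤ) (g' : ι' → ℕ),
      (D' = D ∨ k ^ 16 ≤ D') ∧ D' < (k + 1) ^ 128 ∧ IsBlockFamily n k D' G X' Y' g' ∧
      HasLineBounds X' Y' β (D' ^ 2) ((1 + 1 / (k : ℝ)) * D') (D' / (k : ℝ) + 1) := by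
    intro z
    induction z using Nat.strong_induction_on with
    | _ z ih =>
      rintro hkz ⟨ι', hι', X', Y', g', hF', hL'⟩
      have hkzR : (k : ℝ) ≤ z := by exact_mod_cast hkz
      have hzR : (10 : ℝ) ^ 37 ≤ z := hkR.trans hkzR
      have hz0 : (0 : ℝ) < z := by linarith
      have hz1 : (1 : ℝ) ≤ z := by linarith
      rcases lt_or_ge z (k ^ 8) with h8 | h8
      · refine ⟨z ^ 16, ι', hι', X', Y', g', Or.inr (Nat.pow_le_pow_left hkz 16), ?_, hF',
          hL'.mono hβ0 ?_ ?_⟩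
        · calc z ^ 16 ≤ (k ^ 8) ^ 16 := Nat.pow_le_pow_left h8.le 16
            _ = k ^ 128 := by rw [← pow_mul]
            _ < (k + 1) ^ 128 := Nat.pow_lt_pow_left (Nat.lt_succ_self k) (by norm_num)
        · push_cast
          gcongr
        · have : (z : ℝ) ^ 8 ≤ ((z ^ 16 : ℕ) : ℝ) / k := by
            rw [le_div_iff₀ hk0]
            push_cast
            calc (z : ℝ) ^ 8 * k ≤ (z : ℝ) ^ 8 * z ^ 8 := by
                  gcongr
                  exact hkzR.trans (by simpa using pow_le_pow_right₀ hz1 (show 1 ≤ 8 by norm_num))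
              _ = _ := by rw [← pow_add]
          linarith
      · obtain ⟨y, hy1, hy2⟩ := exists_pow_le_lt_succ_pow z (p := 8) (by norm_num)
        have hky : k ≤ y := by
          by_contra hc
          exact absurd (hy2.trans_le (Nat.pow_le_pow_left (not_le.1 hc) 8)) (not_lt.2 h8)
        have hkyR : (k : ℝ) ≤ y := by exact_mod_cast hky
        have hy0 : (0 : ℝ) < y := by linarith
        have hy1' : (1 : ℝ) ≤ y := by linarith
        have hy4 : (4 : ℝ) ≤ y := le_trans (by norm_num) (hkR.trans hkyR)
        have hy1R : (y : ℝ) ^ 8 ≤ z := by exact_mod_cast hy1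
        have h4y : 4 * (y : ℝ) ≤ z := by
          calc 4 * (y : ℝ) ≤ y * y := by gcongr
            _ = y ^ 2 := by ring
            _ ≤ y ^ 8 := pow_le_pow_right₀ hy1' (by norm_num)
            _ ≤ z := hy1R
        have hyz : y < z := by
          have : (y : ℝ) < z := by linarith
          exact_mod_cast this
        refine ih y hyz hky (exists_refinement hF' β hβ0 hβ8 hβM (hk.trans hky) ?_ ?_
          (hL'.mono hβ0 ?_ ?_))
        · calc y ^ 128 = (y ^ 8) ^ 16 := by rw [← pow_mul]
            _ ≤ z ^ 16 := Nat.pow_le_pow_left hy1 16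
        · calc z ^ 16 < ((y + 1) ^ 8) ^ 16 := Nat.pow_lt_pow_left hy2 (by norm_num)
            _ = (y + 1) ^ 128 := by rw [← pow_mul]
        · push_cast
          gcongr
        · push_cast
          rw [le_div_iff₀ (by positivity)]
          calc (z : ℝ) ^ 8 * y ^ 60 ≤ (z : ℝ) ^ 8 * y ^ 64 := by
                gcongr
                norm_num
            _ = (z : ℝ) ^ 8 * ((y : ℝ) ^ 8) ^ 8 := by rw [← pow_mul]
            _ ≤ (z : ℝ) ^ 8 * z ^ 8 := by gcongr
            _ = _ := by rw [← pow_add]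
  obtain ⟨z, hz1, hz2⟩ := exists_pow_le_lt_succ_pow D (p := 128) (by norm_num)
  have hkz : k ≤ z := by
    by_contra hc
    exact hD (hz2.trans_le (Nat.pow_le_pow_left (by omega) 128))
  have hkzR : (k : ℝ) ≤ z := by exact_mod_cast hkz
  have hz0 : (0 : ℝ) < z := by linarith
  refine key z hkz (exists_refinement hF β hβ0 hβ8 hβM (hk.trans hkz) hz1 hz2 (hL.mono hβ0 ?_ ?_))
  · refine le_mul_of_one_le_left (Nat.cast_nonneg _) ?_
    have : 0 ≤ 1 / (4 * (z : ℝ)) := one_div_nonneg.2 (mul_nonneg zero_le_four hz0.le)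
    linarith
  · rw [le_div_iff₀ (pow_pos hz0 _), one_mul]
    calc (z : ℝ) ^ 60 ≤ (z : ℝ) ^ 128 := pow_le_pow_right₀ (by linarith) (by norm_num)
      _ ≤ D := by exact_mod_cast hz1

end Descent

section RegularSelection

theorem exists_regular_relation (Y : Finset ℤ) (g : ℕ) (hg : g ≤ Y.card) :
    ∃ R : ℤ → ℤ → Prop, (∀ y ∈ Y, {y' | y' ∈ Y ∧ R y' y}.ncard = g) ∧
      ∀ y' ∈ Y, {y | y ∈ Y ∧ R y' y}.ncard = g := by
  rcases Y.eq_empty_or_nonempty with rfl | hne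
  · exact ⟨fun _ _ => True, by simp, by simp⟩
  have : NeZero Y.card := ⟨hne.card_pos.ne'⟩
  let e := Y.equivFin
  have hcount : ((Finset.univ : Finset (Fin Y.card)).filter fun u => u.1 < g).card = g := by
    rw [Fin.card_filter_val_lt]
    omega
  have main : ∀ σ : Y ≃ Fin Y.card, ∀ R : ℤ → Prop,
      (∀ y (h : y ∈ Y), R y ↔ (σ ⟨y, h⟩).1 < g) → {y | y ∈ Y ∧ R y}.ncard = g := by
    intro σ R hR
    rw [← hcount, ← Set.ncard_coe_finset]
    refine Set.ncard_congr (fun y hy => σ ⟨y, hy.1⟩) ?_ ?_ ?_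
    · rintro y ⟨hy, hRy⟩
      simpa using (hR y hy).1 hRy
    · intro y y' hy hy' h
      simpa using σ.injective h
    · intro u hu
      refine ⟨σ.symm u, ⟨(σ.symm u).2, (hR _ (σ.symm u).2).2 ?_⟩, ?_⟩
      · simpa using hu
      · simp
  refine ⟨fun y' y => ∃ (h' : y' ∈ Y) (h : y ∈ Y), (e ⟨y, h⟩ - e ⟨y', h'⟩).1 < g, ?_, ?_⟩
  · intro y hy
    refine main (e.trans (Equiv.subLeft (e ⟨y, hy⟩))) _ fun y' hy' => ?_
    simp [hy, hy']
  · intro y' hy'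
    refine main (e.trans (Equiv.subRight (e ⟨y', hy'⟩))) _ fun y hy => ?_
    simp [hy, hy']

theorem final_pow_le {k D : ℝ} (hk : 10 ^ 37 ≤ k) (hD0 : 0 < D) (hD : D ≤ (k + 1) ^ 128) (m : ℕ)
    (hm : k / 1000 - 1 ≤ m) : (19 / 20 : ℝ) ^ m ≤ 1 / D ^ 8 := by
  have hk0 : 0 < k := by linarith
  obtain ⟨x, hx⟩ : ∃ x, x = √k := ⟨_, rfl⟩
  have hx0 : 0 ≤ x := by rw [hx]; positivity
  have hxk : x ^ 2 = k := by rw [hx]; exact Real.sq_sqrt hk0.le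
  have hx1 : 10 ^ 18 ≤ x := by
    rw [hx]
    refine Real.le_sqrt_of_sq_le ?_
    linarith
  have h1 : (19 / 20 : ℝ) ≤ Real.exp (-(1 / 20)) := by
    have := Real.add_one_le_exp (-(1 / 20) : ℝ)
    linarith
  have h2 : D ^ 8 ≤ Real.exp (2048 * x) := by
    calc D ^ 8 ≤ ((k + 1) ^ 128) ^ 8 := by gcongr
      _ = (k + 1) ^ 1024 := by rw [← pow_mul]
      _ ≤ ((x + 1) ^ 2) ^ 1024 := by
        gcongr
        nlinarith
      _ ≤ ((Real.exp x) ^ 2) ^ 1024 := by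
        gcongr
        exact Real.add_one_le_exp x
      _ = _ := by rw [← pow_mul, ← Real.exp_nat_mul]; norm_num
  calc (19 / 20 : ℝ) ^ m ≤ (Real.exp (-(1 / 20))) ^ m := by gcongr
    _ = Real.exp (-(m / 20)) := by rw [← Real.exp_nat_mul]; congr 1; ring
    _ ≤ Real.exp (-(2048 * x)) := by
      apply Real.exp_le_exp.2
      have : 10 ^ 18 * x ≤ x ^ 2 := by rw [sq]; gcongr
      linarith
    _ = 1 / Real.exp (2048 * x) := by rw [Real.exp_neg, one_div]
    _ ≤ _ := by gcongr

theorem final_ratio_le {k D G L t T : ℝ} (hk : 10 ^ 37 ≤ k) (hD : 18 * k ≤ 100 * D)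
    (hG0 : 0 ≤ G) (hG : 7 * G ≤ k + 7) (hL : L ≤ 6.01 * D) (ht : t ≤ k / 1000)
    (hT : 0.95 * k - 1 ≤ T) : L * (G / (D - t)) / (T + 1 - t) ≤ 19 / 20 := by
  have h1 : 0 < D - t := by linarith
  have h2 : 0 < T + 1 - t := by linarith
  rw [div_le_iff₀ h2, mul_div_assoc', div_le_iff₀ h1]
  have h3 : 0.99 * D ≤ D - t := by linarith
  have h4 : 0.949 * k ≤ T + 1 - t := by linarith
  have hD0 : 0 < D := by linarith
  have hk0 : 0 < k := by linarith
  have h5 : G ≤ 0.1429 * k := by linarith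
  calc L * G ≤ (6.01 * D) * (0.1429 * k) := by gcongr
    _ ≤ 19 / 20 * (0.949 * k) * (0.99 * D) := by nlinarith [mul_pos hD0 hk0]
    _ ≤ _ := by gcongr

end RegularSelection

section RegularSets

/-- A set of lattice points of `[0, n)²` with exactly `k` points in every row and column and at
most `B` points on every oblique line. -/
structure IsRegularSelection (n k B : ℕ) (S : Finset (ℤ × ℤ)) : Prop where
  subset : S ⊆ Finset.Ico 0 (n : ℤ) ×ˢ Finset.Ico 0 (n : ℤ)
  card_fst : ∀ x ∈ Finset.Ico 0 (n : ℤ), (S.filter fun p => p.1 = x).card = k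
  card_snd : ∀ y ∈ Finset.Ico 0 (n : ℤ), (S.filter fun p => p.2 = y).card = k
  card_oblique : ∀ a b c, IsObliqueDir a b → (S.filter fun p => b * p.1 - a * p.2 = c).card ≤ B

open scoped Classical in
theorem IsBlockFamily.isRegularSelection {ι : Type*} [Fintype ι] {n k D G B : ℕ}
    {X Y : ι → Finset ℤ} {g : ι → ℕ} (hF : IsBlockFamily n k D G X Y g)
    (R : ι → ℤ → ℤ → Prop)
    (hR1 : ∀ j, ∀ y ∈ Y j, ((Y j).filter fun y' => R j y' y).card = g j)
    (hR2 : ∀ j, ∀ y' ∈ Y j, ((Y j).filter fun y => R j y' y).card = g j)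
    (w : ι → ℤ → ℤ) (hw : ∀ j, BijOn (w j) (X j) (Y j))
    (hB : ∀ a b c, IsObliqueDir a b → (∑ j, ((X j ×ˢ Y j).filter fun p =>
      b * p.1 - a * p.2 = c ∧ R j (w j p.1) p.2).card) ≤ B) :
    IsRegularSelection n k B
      (Finset.univ.biUnion fun j => (X j ×ˢ Y j).filter fun p => R j (w j p.1) p.2) where
  subset := by
    intro p hp
    simp only [Finset.mem_biUnion, Finset.mem_univ, true_and, Finset.mem_filter,
      Finset.mem_product] at hp
    obtain ⟨j, ⟨h1, h2⟩, -⟩ := hp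
    exact Finset.mem_product.2 ⟨hF.X_subset j h1, hF.Y_subset j h2⟩
  card_fst x hx := by
    rw [← hF.sum_X x hx, Finset.filter_biUnion, Finset.card_biUnion, Finset.sum_filter]
    · refine Finset.sum_congr rfl fun j _ => ?_
      split_ifs with h
      · rw [← hR2 j (w j x) ((hw j).mapsTo h)]
        refine Finset.card_bij' (fun p _ => p.2) (fun y _ => (x, y)) ?_ ?_ ?_ ?_
        · rintro ⟨x', y⟩ hp
          simp only [Finset.mem_filter, Finset.mem_product] at hp ⊢
          obtain ⟨⟨⟨-, h2⟩, h3⟩, rfl⟩ := hp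
          exact ⟨h2, h3⟩
        · intro y hy
          simp only [Finset.mem_filter, Finset.mem_product] at hy ⊢
          exact ⟨⟨⟨h, hy.1⟩, hy.2⟩, trivial⟩
        · rintro ⟨x', y⟩ hp
          simp [(Finset.mem_filter.1 hp).2.symm]
        · intro y _
          rfl
      · rw [Finset.card_eq_zero, Finset.filter_eq_empty_iff]
        rintro ⟨x', y⟩ hp rfl
        exact h (Finset.mem_product.1 (Finset.mem_filter.1 hp).1).1
    · intro j _ j' _ hjj'
      rw [Function.onFun, Finset.disjoint_left]
      rintro ⟨x', y⟩ h1 h2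
      simp only [Finset.mem_filter, Finset.mem_product] at h1 h2
      exact hjj' (hF.disj j j' x' y h1.1.1.1 h2.1.1.1 h1.1.1.2 h2.1.1.2)
  card_snd y hy := by
    rw [← hF.sum_Y y hy, Finset.filter_biUnion, Finset.card_biUnion, Finset.sum_filter]
    · refine Finset.sum_congr rfl fun j _ => ?_
      split_ifs with h
      · rw [← hR1 j y h]
        refine Finset.card_bij (fun p _ => w j p.1) ?_ ?_ ?_
        · rintro ⟨x, y'⟩ hp
          simp only [Finset.mem_filter, Finset.mem_product] at hp ⊢
          obtain ⟨⟨⟨h1, -⟩, h3⟩, rfl⟩ := hp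
          exact ⟨(hw j).mapsTo h1, h3⟩
        · rintro ⟨x, y₁⟩ hp ⟨x', y₂⟩ hp' he
          simp only [Finset.mem_filter, Finset.mem_product] at hp hp'
          rw [(hw j).injOn hp.1.1.1 hp'.1.1.1 he, hp.2, hp'.2]
        · intro v hv
          obtain ⟨h1, h2⟩ := Finset.mem_filter.1 hv
          obtain ⟨x, hx, rfl⟩ := (hw j).surjOn h1
          exact ⟨(x, y), Finset.mem_filter.2 ⟨Finset.mem_filter.2
            ⟨Finset.mem_product.2 ⟨hx, h⟩, h2⟩, rfl⟩, rfl⟩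
      · rw [Finset.card_eq_zero, Finset.filter_eq_empty_iff]
        rintro ⟨x', y'⟩ hp rfl
        exact h (Finset.mem_product.1 (Finset.mem_filter.1 hp).1).2
    · intro j _ j' _ hjj'
      rw [Function.onFun, Finset.disjoint_left]
      rintro ⟨x', y⟩ h1 h2
      simp only [Finset.mem_filter, Finset.mem_product] at h1 h2
      exact hjj' (hF.disj j j' x' y h1.1.1.1 h2.1.1.1 h1.1.1.2 h2.1.1.2)
  card_oblique a b c hab := by
    refine le_trans ?_ (hB a b c hab)
    rw [Finset.filter_biUnion]
    refine Finset.card_biUnion_le.trans (Finset.sum_le_sum fun j _ => Finset.card_le_card ?_)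
    intro p hp
    simp only [Finset.mem_filter] at hp ⊢
    exact ⟨hp.1.1, hp.2, hp.1.2⟩

/-- A family of blocks of moderate scale yields a regular selection. -/
theorem exists_isRegularSelection_of_family {ι : Type} [Fintype ι] {n k D G : ℕ}
    {X Y : ι → Finset ℤ} {g : ι → ℕ} (hF : IsBlockFamily n k D G X Y g) (β : ℕ → ℝ)
    (hβ0 : ∀ M, 0 ≤ β M) (hβ6 : ∀ M, β M ≤ 6) (hk : 10 ^ 37 ≤ k) (hD : 18 * k ≤ 100 * D)
    (hDk : D < (k + 1) ^ 128) (hG : 7 * G ≤ k + 7)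
    (hL : HasLineBounds X Y β (D ^ 2) ((1 + 1 / (k : ℝ)) * D) (D / (k : ℝ) + 1)) :
    ∃ S, IsRegularSelection n k (95 * k / 100) S := by
  classical
  have hkR : (10 : ℝ) ^ 37 ≤ k := by exact_mod_cast hk
  have hk6 : 1000000 ≤ k := le_trans (by norm_num) hk
  have hDR : 18 * (k : ℝ) ≤ 100 * D := by exact_mod_cast hD
  have hDkR : (D : ℝ) ≤ ((k : ℝ) + 1) ^ 128 := by exact_mod_cast hDk.le
  have hGR : 7 * (G : ℝ) ≤ k + 7 := by exact_mod_cast hG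
  clear hk hDk
  have hk0 : (0 : ℝ) < k := by linarith
  have hD0 : (0 : ℝ) < D := by linarith
  have hU : ∀ M, (1 + 1 / (k : ℝ)) * D * β M + (D / (k : ℝ) + 1) ≤ 6.01 * (D : ℝ) := by
    intro M
    have h1 : (1 : ℝ) / k ≤ 0.001 := by
      rw [div_le_iff₀ hk0]
      linarith
    have h2 : (D : ℝ) / k ≤ 0.001 * D := by
      rw [div_eq_mul_one_div, mul_comm]
      gcongr
    calc _ ≤ (1 + 0.001) * (D : ℝ) * 6 + (0.001 * (D : ℝ) + 1) := by
          gcongr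
          · exact hβ0 M
          · exact hβ6 M
      _ ≤ 6.01 * (D : ℝ) := by linarith
  let L := ⌊6.01 * (D : ℝ)⌋₊
  have hLR : (L : ℝ) ≤ 6.01 * D := Nat.floor_le (by positivity)
  choose R hR1 hR2 using fun j => exists_regular_relation (Y j) (g j)
    (by have := hF.g_le j; have := hF.le_card j; omega)
  have hcard : ∀ (A : Finset ℤ) (p : ℤ → Prop), {y | y ∈ A ∧ p y}.ncard = (A.filter p).card := by
    intro A p
    rw [← Set.ncard_coe_finset, Finset.coe_filter]
  simp only [hcard] at hR1 hR2
  have ht : ((k / 1000 : ℕ) : ℝ) ≤ (k : ℝ) / 1000 := by exact_mod_cast Nat.cast_div_le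
  have ht' : (k : ℝ) / 1000 - 1 ≤ ((k / 1000 : ℕ) : ℝ) := by
    have : k ≤ 1000 * (k / 1000) + 1000 := by omega
    have : (k : ℝ) ≤ 1000 * ((k / 1000 : ℕ) : ℝ) + 1000 := by exact_mod_cast this
    linarith
  have hT : 0.95 * (k : ℝ) - 1 ≤ ((95 * k / 100 : ℕ) : ℝ) := by
    have : 95 * k ≤ 100 * (95 * k / 100) + 100 := by omega
    have : 95 * (k : ℝ) ≤ 100 * ((95 * k / 100 : ℕ) : ℝ) + 100 := by exact_mod_cast this
    linarith
  have hratio := final_ratio_le (L := L) (t := ((k / 1000 : ℕ) : ℝ)) hkR hDR (Nat.cast_nonneg G)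
    hGR hLR ht hT
  have hnonneg : 0 ≤ (L : ℝ) * ((G : ℝ) / (D - ((k / 1000 : ℕ) : ℝ))) /
      (((95 * k / 100 : ℕ) : ℝ) + 1 - ((k / 1000 : ℕ) : ℝ)) := by
    refine div_nonneg (mul_nonneg (Nat.cast_nonneg _) (div_nonneg (Nat.cast_nonneg _) ?_)) ?_ <;>
    linarith
  obtain ⟨w, hw, hline⟩ := exists_bijOn_forall_line_lt hF (by omega) R G
    (fun j y hy => ((hR1 j y hy).trans_le (hF.g_le j)).trans' (by convert le_rfl))
    (fun _ _ => k / 1000) (fun _ _ => 95 * k / 100) (fun _ _ => L)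
    (fun a b c hab _ => Nat.le_floor ((hL a b c hab).1.trans (hU _)))
    (fun _ _ _ _ => Nat.floor_le_of_le (by push_cast; linarith))
    (fun _ _ _ _ => by omega) (fun _ _ _ _ => by omega) (fun _ _ _ _ => by omega)
    (fun _ _ _ _ => (pow_le_pow_left₀ hnonneg hratio _).trans
      (final_pow_le hkR hD0 hDkR _ ht'))
  refine ⟨_, hF.isRegularSelection R (fun j y hy => by convert hR1 j y hy)
    (fun j y hy => by convert hR2 j y hy) w hw fun a b c hab => ?_⟩
  rcases lt_or_ge (dirHeight a b) (D ^ 2) with hM | hM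
  · exact le_trans (by convert le_rfl) (hline a b c hab hM).le
  · have h1 := (hL a b c hab).2 hM
    have h2 : ∑ j, ((X j ×ˢ Y j).filter fun p =>
        b * p.1 - a * p.2 = c ∧ R j (w j p.1) p.2).card ≤ lineCount X Y a b c :=
      Finset.sum_le_sum fun j _ => Finset.card_le_card fun p hp =>
        Finset.mem_filter.2 ⟨(Finset.mem_filter.1 hp).1, (Finset.mem_filter.1 hp).2.1⟩
    refine le_trans (by convert le_rfl) ((h2.trans h1).trans ?_)
    omega

end RegularSets

section InitialFamily

theorem IsObliqueDir.one_le_dirHeight {a b : ℤ} (h : IsObliqueDir a b) : 1 ≤ dirHeight a b :=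
  le_max_of_le_left (Int.natAbs_pos.2 h.1)

theorem card_le_of_line_of_snd {a b c : ℤ} (hb : b ≠ 0) (hab : IsCoprime a b) (n : ℕ)
    {P : Finset (ℤ × ℤ)} (hP : ∀ p ∈ P, p.2 ∈ Finset.Ico 0 (n : ℤ))
    (hl : ∀ p ∈ P, b * p.1 - a * p.2 = c) : P.card ≤ n / b.natAbs + 1 := by
  have hb0 : (0 : ℤ) < b.natAbs := by omega
  have : (Finset.range (n / b.natAbs + 1)).card = n / b.natAbs + 1 := Finset.card_range _
  rw [← this]
  refine Finset.card_le_card_of_injOn (fun p => (p.2 / b.natAbs).toNat) ?_ ?_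
  · intro p hp
    have h := Finset.mem_Ico.1 (hP p hp)
    have h1 : p.2 / (b.natAbs : ℤ) ≤ (n : ℤ) / (b.natAbs : ℤ) := Int.ediv_le_ediv hb0 h.2.le
    have h2 : ((n / b.natAbs : ℕ) : ℤ) = (n : ℤ) / (b.natAbs : ℤ) := Int.natCast_div _ _
    have h3 : 0 ≤ p.2 / (b.natAbs : ℤ) := Int.ediv_nonneg h.1 hb0.le
    rw [Finset.coe_range, Set.mem_Iio]
    change (p.2 / (b.natAbs : ℤ)).toNat < _
    omega
  · intro p hp q hq hpq
    have h1 := hl p hp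
    have h2 := hl q hq
    have h3 : 0 ≤ p.2 / (b.natAbs : ℤ) := Int.ediv_nonneg (Finset.mem_Ico.1 (hP p hp)).1 hb0.le
    have h4 : 0 ≤ q.2 / (b.natAbs : ℤ) := Int.ediv_nonneg (Finset.mem_Ico.1 (hP q hq)).1 hb0.le
    have h5 : p.2 / (b.natAbs : ℤ) = q.2 / (b.natAbs : ℤ) := by
      have : (p.2 / (b.natAbs : ℤ)).toNat = (q.2 / (b.natAbs : ℤ)).toNat := hpq
      omega
    have h6 : b ∣ p.2 - q.2 := by
      refine hab.symm.dvd_of_dvd_mul_left ⟨p.1 - q.1, ?_⟩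
      linarith
    have h7 : p.2 % (b.natAbs : ℤ) = q.2 % (b.natAbs : ℤ) :=
      Int.emod_eq_emod_iff_emod_sub_eq_zero.2 (Int.emod_eq_zero_of_dvd (Int.natAbs_dvd.2 h6))
    have h8 : p.2 = q.2 := by
      rw [← Int.mul_ediv_add_emod p.2 b.natAbs, ← Int.mul_ediv_add_emod q.2 b.natAbs, h5, h7]
    have h9 : b * p.1 = b * q.1 := by
      rw [h8] at h1
      linarith
    exact Prod.ext (mul_left_cancel₀ hb h9) h8

/-- A line of height `M` contains at most `n / M + 1` points of the square `[0, n)²`. -/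
theorem card_le_of_line {a b c : ℤ} (hab : IsObliqueDir a b) (n : ℕ)
    {P : Finset (ℤ × ℤ)} (hP : P ⊆ Finset.Ico 0 (n : ℤ) ×ˢ Finset.Ico 0 (n : ℤ))
    (hl : ∀ p ∈ P, b * p.1 - a * p.2 = c) : P.card ≤ n / dirHeight a b + 1 := by
  unfold dirHeight
  rcases le_total a.natAbs b.natAbs with h | h
  · rw [max_eq_right h]
    exact card_le_of_line_of_snd hab.2.1 hab.2.2 n (fun p hp => (Finset.mem_product.1 (hP hp)).2) hl
  · rw [max_eq_left h, ← Finset.card_image_of_injective P Prod.swap_injective]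
    refine card_le_of_line_of_snd (c := -c) hab.1 hab.2.2.symm n ?_ ?_
    · intro p hp
      obtain ⟨q, hq, rfl⟩ := Finset.mem_image.1 hp
      exact (Finset.mem_product.1 (hP hq)).1
    · intro p hp
      obtain ⟨q, hq, rfl⟩ := Finset.mem_image.1 hp
      have := hl q hq
      simp only [Prod.fst_swap, Prod.snd_swap]
      linarith

theorem IsBlockFamily.lineCount_le {ι : Type*} [Fintype ι] {n k D G : ℕ}
    {X Y : ι → Finset ℤ} {g : ι → ℕ} (hF : IsBlockFamily n k D G X Y g) {a b : ℤ} (c : ℤ)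
    (hab : IsObliqueDir a b) : lineCount X Y a b c ≤ n / dirHeight a b + 1 := by
  classical
  unfold lineCount
  rw [← Finset.card_biUnion]
  · refine card_le_of_line hab n (c := c) ?_ ?_
    · intro p hp
      obtain ⟨j, -, hj⟩ := Finset.mem_biUnion.1 hp
      have h := Finset.mem_product.1 (Finset.mem_filter.1 hj).1
      exact Finset.mem_product.2 ⟨hF.X_subset j h.1, hF.Y_subset j h.2⟩
    · intro p hp
      obtain ⟨j, -, hj⟩ := Finset.mem_biUnion.1 hp
      exact (Finset.mem_filter.1 hj).2
  · intro j _ j' _ hjj'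
    rw [Function.onFun, Finset.disjoint_left]
    rintro ⟨x, y⟩ h1 h2
    simp only [Finset.mem_filter, Finset.mem_product] at h1 h2
    exact hjj' (hF.disj j j' x y h1.1.1 h2.1.1 h1.1.2 h2.1.2)

/-- A permutation meeting both main diagonals of the `8 × 8` board twice, and each of the
adjacent diagonals at least once. -/
def boardPerm : Fin 8 → Fin 8 := ![0, 1, 4, 5, 3, 2, 7, 6]

/-- The column of the `i`-th cell in a given row of the complement of `boardPerm`. -/
def boardCol (q : Fin 8 × Fin 7) : Fin 8 := boardPerm q.1 + q.2.succ

theorem boardCol_injective (I : Fin 8) (i i' : Fin 7) (h : boardCol (I, i) = boardCol (I, i')) :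
    i = i' := by
  revert I i i'
  decide

theorem exists_boardCol_eq_iff (i : Fin 7) (J : Fin 8) :
    ∃ I₀, ∀ I, boardCol (I, i) = J ↔ I = I₀ := by
  revert i J
  decide

theorem boardCol_ne (q : Fin 8 × Fin 7) : boardCol q ≠ boardPerm q.1 := by
  revert q
  decide

theorem card_diagonal_le (d : Fin 15) :
    (Finset.univ.filter fun I : Fin 8 =>
      7 ≤ I.1 + d.1 ∧ I.1 + d.1 < 15 ∧ I.1 + d.1 ≠ (boardPerm I).1 + 7).card ≤ 6 := by
  revert d
  decide

theorem card_antidiagonal_le (d : Fin 15) :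
    (Finset.univ.filter fun I : Fin 8 =>
      I.1 ≤ d.1 ∧ d.1 < I.1 + 8 ∧ d.1 ≠ (boardPerm I).1 + I.1).card ≤ 6 := by
  revert d
  decide

theorem card_diagonal_int_le (e δ : ℤ) (he : e = 1 ∨ e = -1) :
    (Finset.univ.filter fun p : Fin 8 × Fin 7 =>
      ((boardCol p).1 : ℤ) = e * (p.1.1 : ℤ) + δ).card ≤ 6 := by
  rcases Finset.eq_empty_or_nonempty (Finset.univ.filter fun p : Fin 8 × Fin 7 =>
      ((boardCol p).1 : ℤ) = e * (p.1.1 : ℤ) + δ) with h | ⟨q, hq⟩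
  · rw [h]
    simp
  have hq := (Finset.mem_filter.1 hq).2
  have hinj : InjOn Prod.fst (Finset.univ.filter fun p : Fin 8 × Fin 7 =>
      ((boardCol p).1 : ℤ) = e * (p.1.1 : ℤ) + δ : Set (Fin 8 × Fin 7)) := by
    rintro ⟨I, i⟩ hp ⟨I', i'⟩ hp' (rfl : I = I')
    have hp : ((boardCol (I, i)).1 : ℤ) = e * (I.1 : ℤ) + δ :=
      (Finset.mem_filter.1 (Finset.mem_coe.1 hp)).2
    have hp' : ((boardCol (I, i')).1 : ℤ) = e * (I.1 : ℤ) + δ :=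
      (Finset.mem_filter.1 (Finset.mem_coe.1 hp')).2
    rw [boardCol_injective I i i' (Fin.ext (by exact_mod_cast hp.trans hp'.symm))]
  rcases he with rfl | rfl
  · refine (Finset.card_le_card_of_injOn Prod.fst (fun p hp => ?_) hinj).trans
      (card_diagonal_le ⟨(δ + 7).toNat, by omega⟩)
    have hp := (Finset.mem_filter.1 (Finset.mem_coe.1 hp)).2
    have hne : (boardCol p).1 ≠ (boardPerm p.1).1 := fun h => boardCol_ne p (Fin.ext h)
    refine Finset.mem_coe.2 (Finset.mem_filter.2 ⟨Finset.mem_univ _, ?_⟩)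
    dsimp only
    omega
  · refine (Finset.card_le_card_of_injOn Prod.fst (fun p hp => ?_) hinj).trans
      (card_antidiagonal_le ⟨δ.toNat, by omega⟩)
    have hp := (Finset.mem_filter.1 (Finset.mem_coe.1 hp)).2
    have hne : (boardCol p).1 ≠ (boardPerm p.1).1 := fun h => boardCol_ne p (Fin.ext h)
    refine Finset.mem_coe.2 (Finset.mem_filter.2 ⟨Finset.mem_univ _, ?_⟩)
    dsimp only
    omega

/-- The `I`-th of eight consecutive intervals of length `D`. -/
def boardBlock (D : ℕ) (I : Fin 8) : Finset ℤ :=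
  Finset.Ico ((I.1 : ℤ) * D) ((I.1 + 1 : ℤ) * D)

theorem mem_boardBlock {D : ℕ} (hD : 0 < D) {I : Fin 8} {x : ℤ} :
    x ∈ boardBlock D I ↔ x / D = I.1 := by
  have h : (0 : ℤ) < D := by exact_mod_cast hD
  rw [boardBlock, Finset.mem_Ico, ← Int.le_ediv_iff_mul_le h, ← Int.ediv_lt_iff_lt_mul h]
  omega

theorem card_boardBlock (D : ℕ) (I : Fin 8) : (boardBlock D I).card = D := by
  rw [boardBlock, Int.card_Ico]
  have : ((I.1 + 1 : ℤ) * D) - ((I.1 : ℤ) * D) = D := by ring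
  rw [this, Int.toNat_natCast]

theorem boardBlock_subset (D : ℕ) (I : Fin 8) :
    boardBlock D I ⊆ Finset.Ico 0 ((8 * D : ℕ) : ℤ) := by
  intro x hx
  rw [boardBlock, Finset.mem_Ico] at hx
  have h0 : (0 : ℤ) ≤ D := Int.natCast_nonneg D
  have h1 : (I.1 : ℤ) + 1 ≤ 8 := by have := I.2; omega
  have h2 : (0 : ℤ) ≤ I.1 := Int.natCast_nonneg _
  rw [Finset.mem_Ico]
  push_cast
  constructor
  · nlinarith
  · nlinarith

theorem exists_mem_boardBlock_iff {D : ℕ} (hD : 0 < D) {x : ℤ}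
    (hx : x ∈ Finset.Ico 0 ((8 * D : ℕ) : ℤ)) : ∃ I₀, ∀ I, x ∈ boardBlock D I ↔ I = I₀ := by
  have h : (0 : ℤ) < D := by exact_mod_cast hD
  rw [Finset.mem_Ico] at hx
  push_cast at hx
  have h1 : 0 ≤ x / D := Int.ediv_nonneg hx.1 h.le
  have h2 : x / D < 8 := Int.ediv_lt_of_lt_mul h hx.2
  refine ⟨⟨(x / D).toNat, by omega⟩, fun I => ?_⟩
  rw [mem_boardBlock hD, Fin.ext_iff]
  change _ ↔ I.1 = (x / D).toNat
  omega

/-- Almost equal multiplicities with sum `k`. -/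
def boardMult (k : ℕ) (i : Fin 7) : ℕ := k / 7 + if i.1 < k % 7 then 1 else 0

theorem sum_boardMult (k : ℕ) : ∑ i, boardMult k i = k := by
  have : ∀ i : Fin 7, i.1 < 7 := fun i => i.2
  simp only [boardMult, Fin.sum_univ_seven]
  simp only [Fin.isValue, Fin.val_zero, Fin.val_one, Fin.val_two]
  have h3 : ((3 : Fin 7) : ℕ) = 3 := rfl
  have h4 : ((4 : Fin 7) : ℕ) = 4 := rfl
  have h5 : ((5 : Fin 7) : ℕ) = 5 := rfl
  have h6 : ((6 : Fin 7) : ℕ) = 6 := rfl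
  rw [h3, h4, h5, h6]
  split_ifs <;> omega

theorem isBlockFamily_board {D : ℕ} (hD : 0 < D) (k : ℕ) :
    IsBlockFamily (8 * D) k D (k / 7 + 1) (fun q : Fin 8 × Fin 7 => boardBlock D q.1)
      (fun q => boardBlock D (boardCol q)) (fun q => boardMult k q.2) where
  card_eq q := by rw [card_boardBlock, card_boardBlock]
  le_card q := (card_boardBlock _ _).ge
  card_le q := by rw [card_boardBlock]; omega
  X_subset q := boardBlock_subset _ _
  Y_subset q := boardBlock_subset _ _
  disj := by
    rintro ⟨I, i⟩ ⟨I', i'⟩ x y h1 h2 h3 h4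
    obtain ⟨I₀, h⟩ := exists_mem_boardBlock_iff hD (boardBlock_subset _ _ h1)
    obtain ⟨J₀, h'⟩ := exists_mem_boardBlock_iff hD (boardBlock_subset _ _ h3)
    have hI : I = I' := ((h I).1 h1).trans ((h I').1 h2).symm
    subst hI
    rw [boardCol_injective I i i' (((h' _).1 h3).trans ((h' _).1 h4).symm)]
  sum_X x hx := by
    obtain ⟨I₀, h⟩ := exists_mem_boardBlock_iff hD hx
    simp only [h]
    rw [Finset.sum_filter, Fintype.sum_prod_type]
    simp [sum_boardMult]
  sum_Y y hy := by
    obtain ⟨J₀, h⟩ := exists_mem_boardBlock_iff hD hy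
    simp only [h]
    rw [Finset.sum_filter, Fintype.sum_prod_type, Finset.sum_comm]
    refine (Finset.sum_congr rfl fun i _ => ?_).trans (sum_boardMult k)
    obtain ⟨I₀, h'⟩ := exists_boardCol_eq_iff i J₀
    simp [h']
  g_le q := by
    simp only [boardMult]
    split_ifs <;> omega

/-- Diagonal lines meet the blocks of the board in at most `6 D` points. -/
theorem lineCount_board_le {D : ℕ} (hD : 0 < D) {a b : ℤ} (c : ℤ) (ha : a = 1 ∨ a = -1)
    (hb : b = 1 ∨ b = -1) :
    lineCount (fun q : Fin 8 × Fin 7 => boardBlock D q.1)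
      (fun q => boardBlock D (boardCol q)) a b c ≤ 6 * D := by
  have hD0 : (D : ℤ) ≠ 0 := by exact_mod_cast hD.ne'
  obtain ⟨e, f, he, hline⟩ : ∃ e f : ℤ, (e = 1 ∨ e = -1) ∧
      ∀ x y : ℤ, b * x - a * y = c → y = e * x + f := by
    rcases ha with rfl | rfl <;> rcases hb with rfl | rfl
    · exact ⟨1, -c, by simp, fun x y h => by linarith⟩
    · exact ⟨-1, -c, by simp, fun x y h => by linarith⟩
    · exact ⟨-1, c, by simp, fun x y h => by linarith⟩
    · exact ⟨1, c, by simp, fun x y h => by linarith⟩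
  unfold lineCount
  calc _ ≤ ∑ q : Fin 8 × Fin 7, ((Finset.Ico 0 (D : ℤ)).filter fun s =>
        ((boardCol q).1 : ℤ) = e * (q.1.1 : ℤ) + (e * s + f) / D).card := by
        refine Finset.sum_le_sum fun q _ => ?_
        refine Finset.card_le_card_of_injOn (fun p => p.1 - q.1.1 * D) ?_ ?_
        · rintro ⟨x, y⟩ hp
          simp only [Finset.coe_filter, Finset.mem_product, Set.mem_ofPred_eq] at hp ⊢
          obtain ⟨⟨h1, h2⟩, h3⟩ := hp
          rw [mem_boardBlock hD] at h2
          rw [boardBlock, Finset.mem_Ico] at h1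
          refine ⟨Finset.mem_Ico.2 ⟨by linarith, by linarith⟩, ?_⟩
          rw [← h2, hline _ _ h3]
          have : e * x + f = e * (x - q.1.1 * D) + f + e * q.1.1 * D := by ring
          rw [this, Int.add_mul_ediv_right _ _ hD0]
          ring
        · rintro ⟨x, y⟩ hp ⟨x', y'⟩ hp' h
          simp only [Finset.coe_filter, Finset.mem_product, Set.mem_ofPred_eq] at hp hp' h
          have hx : x = x' := by linarith
          rw [hline _ _ hp.2, hline _ _ hp'.2, hx]
    _ = ∑ s ∈ Finset.Ico 0 (D : ℤ), (Finset.univ.filter fun q : Fin 8 × Fin 7 =>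
        ((boardCol q).1 : ℤ) = e * (q.1.1 : ℤ) + (e * s + f) / D).card := by
        simp only [Finset.card_filter]
        exact Finset.sum_comm
    _ ≤ ∑ s ∈ Finset.Ico 0 (D : ℤ), 6 :=
        Finset.sum_le_sum fun s _ => card_diagonal_int_le e _ he
    _ = 6 * D := by simp [mul_comm]

/-- The density of the board along lines of height `M`. -/
def boardDensity (M : ℕ) : ℝ := if M ≤ 1 then 6 else 8 / M

theorem boardDensity_nonneg (M : ℕ) : 0 ≤ boardDensity M := by
  unfold boardDensity
  split_ifs <;> positivity

theorem boardDensity_le (M : ℕ) : boardDensity M ≤ 6 := by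
  unfold boardDensity
  split_ifs with h
  · rfl
  · have : (2 : ℝ) ≤ M := by exact_mod_cast not_le.1 h
    rw [div_le_iff₀ (by linarith)]
    linarith

theorem boardDensity_mul_le (M : ℕ) : boardDensity M * M ≤ 8 := by
  unfold boardDensity
  split_ifs with h
  · have : (M : ℝ) ≤ 1 := by exact_mod_cast h
    linarith
  · have : (2 : ℝ) ≤ M := by exact_mod_cast not_le.1 h
    rw [div_mul_cancel₀ _ (by linarith)]

theorem hasLineBounds_board {D : ℕ} (hD : 0 < D) :
    HasLineBounds (fun q : Fin 8 × Fin 7 => boardBlock D q.1)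
      (fun q => boardBlock D (boardCol q)) boardDensity (D ^ 2) D 1 := by
  intro a b c hab
  have hM := hab.one_le_dirHeight
  have hle := (isBlockFamily_board hD 0).lineCount_le c hab
  refine ⟨?_, fun h => hle.trans ?_⟩
  · rcases hM.eq_or_lt with h | h
    · have h1 : a.natAbs ≤ 1 := (le_max_left _ _).trans h.ge
      have h2 : b.natAbs ≤ 1 := (le_max_right _ _).trans h.ge
      have h3 := hab.1
      have h4 := hab.2.1
      have h5 : (lineCount (fun q : Fin 8 × Fin 7 => boardBlock D q.1)
          (fun q => boardBlock D (boardCol q)) a b c : ℝ) ≤ 6 * D := by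
        exact_mod_cast lineCount_board_le hD c (by omega) (by omega)
      rw [boardDensity, if_pos h.ge]
      linarith
    · rw [boardDensity, if_neg (by omega)]
      calc _ ≤ ((8 * D / dirHeight a b + 1 : ℕ) : ℝ) := by exact_mod_cast hle
        _ ≤ ((8 * D : ℕ) : ℝ) / dirHeight a b + 1 := by
          push_cast
          gcongr
          exact_mod_cast Nat.cast_div_le (α := ℝ) (m := 8 * D) (n := dirHeight a b)
        _ = _ := by
          push_cast
          ring
  · have h1 : 8 * D / dirHeight a b ≤ 8 := by
      refine Nat.div_le_of_le_mul ?_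
      nlinarith
    omega

end InitialFamily

section SparseCase

theorem exists_isRegularSelection_div_eight {n k : ℕ} (hk : 10 ^ 37 ≤ k) (hkn : 3 * k ≤ 2 * n) :
    ∃ S, IsRegularSelection (8 * (n / 8)) k (95 * k / 100) S := by
  have hk6 : 1000000 ≤ k := le_trans (by norm_num) hk
  have hD : 0 < n / 8 := by omega
  obtain ⟨D', ι', hι', X', Y', g', hD', hlt, hF, hL⟩ := exists_family_of_moderate_scale
    (isBlockFamily_board hD k) boardDensity boardDensity_nonneg
    (fun M => (boardDensity_le M).trans (by norm_num)) boardDensity_mul_le hk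
    (hasLineBounds_board hD)
  refine exists_isRegularSelection_of_family hF boardDensity boardDensity_nonneg boardDensity_le hk
    ?_ hlt (by omega) hL
  rcases hD' with rfl | h
  · omega
  · have := Nat.le_self_pow (n := 16) (by norm_num) k
    omega

theorem IsRegularSelection.mono {n k B B' : ℕ} {S : Finset (ℤ × ℤ)}
    (hS : IsRegularSelection n k B S) (h : B ≤ B') : IsRegularSelection n k B' S :=
  ⟨hS.subset, hS.card_fst, hS.card_snd, fun a b c hab => (hS.card_oblique a b c hab).trans h⟩

/-- A regular selection contains a perfect matching of rows with columns. -/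
theorem IsRegularSelection.exists_matching {n k B : ℕ} {S : Finset (ℤ × ℤ)}
    (hS : IsRegularSelection n k B S) (hk : 0 < k) :
    ∃ f : ℤ → ℤ, InjOn f (Finset.Ico 0 (n : ℤ)) ∧ ∀ x ∈ Finset.Ico 0 (n : ℤ), (x, f x) ∈ S := by
  classical
  let t : Finset.Ico 0 (n : ℤ) → Finset ℤ := fun x => (S.filter fun p => p.1 = (x : ℤ)).image Prod.snd
  have ht : ∀ x y, y ∈ t x ↔ ((x : ℤ), y) ∈ S := by
    intro x y
    simp only [t, Finset.mem_image, Finset.mem_filter]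
    constructor
    · rintro ⟨⟨x', y'⟩, ⟨h, rfl⟩, rfl⟩
      exact h
    · intro h
      exact ⟨_, ⟨h, rfl⟩, rfl⟩
  obtain ⟨f, hf, hft⟩ := (Finset.all_card_le_biUnion_card_iff_exists_injective t).1 fun s => by
    refine Nat.le_of_mul_le_mul_right (c := k) ?_ hk
    refine Finset.card_mul_le_card_mul (fun (x : Finset.Ico 0 (n : ℤ)) y => ((x : ℤ), y) ∈ S) ?_ ?_
    · intro x hx
      rw [← hS.card_fst x x.2]
      refine Finset.card_le_card_of_injOn Prod.snd ?_ ?_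
      · rintro ⟨x', y⟩ hp
        simp only [Finset.coe_filter, Set.mem_ofPred_eq] at hp
        obtain ⟨h1, rfl⟩ := hp
        exact Finset.mem_coe.2 (Finset.mem_filter.2
          ⟨Finset.mem_biUnion.2 ⟨x, hx, (ht x y).2 h1⟩, h1⟩)
      · rintro ⟨x', y⟩ hp ⟨x'', y'⟩ hp' h
        simp only [Finset.coe_filter, Set.mem_ofPred_eq] at hp hp' h
        rw [hp.2, hp'.2, h]
    · intro y hy
      obtain ⟨x, -, hx⟩ := Finset.mem_biUnion.1 hy
      have hy' := (Finset.mem_product.1 (hS.subset ((ht x y).1 hx))).2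
      rw [← hS.card_snd y hy']
      refine Finset.card_le_card_of_injOn (fun x => ((x : ℤ), y)) ?_ ?_
      · intro x' hx'
        exact Finset.mem_coe.2 (Finset.mem_filter.2 ⟨(Finset.mem_filter.1 hx').2, rfl⟩)
      · intro x' _ x'' _ h
        exact Subtype.ext (Prod.ext_iff.1 h).1
  refine ⟨fun x => if h : x ∈ Finset.Ico 0 (n : ℤ) then f ⟨x, h⟩ else 0, ?_, ?_⟩
  · intro x hx x' hx' h
    have hx := Finset.mem_coe.1 hx
    have hx' := Finset.mem_coe.1 hx'
    simp only [dif_pos hx, dif_pos hx'] at h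
    exact (Subtype.ext_iff.1 (hf h))
  · intro x hx
    simp only [dif_pos hx]
    exact (ht ⟨x, hx⟩ _).1 (hft ⟨x, hx⟩)

theorem IsRegularSelection.exists_succ {n k B : ℕ} {S : Finset (ℤ × ℤ)}
    (hS : IsRegularSelection n k B S) (hk : 0 < k) (hkn : k ≤ n) :
    ∃ S', IsRegularSelection (n + 1) k (B + 2) S' := by
  classical
  obtain ⟨f, hf, hfS⟩ := hS.exists_matching hk
  have hin : ∀ x y, (x, y) ∈ S → (0 ≤ x ∧ x < n) ∧ 0 ≤ y ∧ y < n := by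
    intro x y h
    have := hS.subset h
    simpa only [Finset.mem_product, Finset.mem_Ico] using this
  have hfk : ∀ x : ℤ, 0 ≤ x → x < k → (x, f x) ∈ S := fun x h0 h1 =>
    hfS x (Finset.mem_Ico.2 ⟨h0, by omega⟩)
  have hfi : ∀ x x' : ℤ, 0 ≤ x → x < k → 0 ≤ x' → x' < k → f x = f x' → x = x' :=
    fun x x' h0 h1 h0' h1' h => hf (by simp; omega) (by simp; omega) h
  have hcard : (Finset.Ico 0 (k : ℤ)).card = k := by simp
  let A : Finset (ℤ × ℤ) := (Finset.Ico 0 (k : ℤ)).image fun x => (x, (n : ℤ))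
  let C : Finset (ℤ × ℤ) := (Finset.Ico 0 (k : ℤ)).image fun x => ((n : ℤ), f x)
  let S₀ := S.filter fun p => ¬ (p.1 < (k : ℤ) ∧ p.2 = f p.1)
  have hA : ∀ x y, (x, y) ∈ A ↔ (0 ≤ x ∧ x < k) ∧ y = n := by
    intro x y
    simp only [A, Finset.mem_image, Finset.mem_Ico, Prod.mk.injEq]
    constructor
    · rintro ⟨x', h, rfl, rfl⟩
      exact ⟨h, rfl⟩
    · rintro ⟨h, rfl⟩
      exact ⟨x, h, rfl, rfl⟩
  have hC : ∀ x y, (x, y) ∈ C ↔ x = n ∧ ∃ x' : ℤ, (0 ≤ x' ∧ x' < k) ∧ f x' = y := by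
    intro x y
    simp only [C, Finset.mem_image, Finset.mem_Ico, Prod.mk.injEq]
    constructor
    · rintro ⟨x', h, rfl, rfl⟩
      exact ⟨rfl, x', h, rfl⟩
    · rintro ⟨rfl, x', h, rfl⟩
      exact ⟨x', h, rfl, rfl⟩
  have hS₀ : ∀ x y, (x, y) ∈ S₀ ↔ (x, y) ∈ S ∧ ¬ (x < k ∧ y = f x) := by
    intro x y
    simp only [S₀, Finset.mem_filter]
  have hmem : ∀ x y, (x, y) ∈ S₀ ∪ A ∪ C ↔ ((x, y) ∈ S ∧ ¬ (x < k ∧ y = f x)) ∨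
      ((0 ≤ x ∧ x < k) ∧ y = n) ∨ x = n ∧ ∃ x' : ℤ, (0 ≤ x' ∧ x' < k) ∧ f x' = y := by
    intro x y
    rw [Finset.mem_union, Finset.mem_union, hS₀, hA, hC, or_assoc]
  refine ⟨S₀ ∪ A ∪ C, ?_, ?_, ?_, ?_⟩
  · rintro ⟨x, y⟩ h
    rw [Finset.mem_product, Finset.mem_Ico, Finset.mem_Ico]
    push_cast
    rcases (hmem x y).1 h with h | h | ⟨h, x', h', rfl⟩
    · have := hin x y h.1
      omega
    · omega
    · have := hin _ _ (hfk x' h'.1 h'.2)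
      omega
  · intro x hx
    rw [Finset.mem_Ico] at hx
    push_cast at hx
    rcases (show x ≤ n by omega).eq_or_lt with rfl | hxn
    · rw [← hcard, ← Finset.card_image_of_injOn (s := Finset.Ico 0 (k : ℤ))
        (f := fun x => ((n : ℤ), f x))]
      · congr 1
        ext ⟨x, y⟩
        change _ ↔ (x, y) ∈ C
        rw [Finset.mem_filter, hmem, hC]
        constructor
        · rintro ⟨h | h | h, rfl⟩
          · have := hin _ y h.1
            omega
          · omega
          · exact h
        · intro h
          exact ⟨Or.inr (Or.inr h), h.1⟩
      · intro x hx x' hx' h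
        have hx := Finset.mem_Ico.1 (Finset.mem_coe.1 hx)
        have hx' := Finset.mem_Ico.1 (Finset.mem_coe.1 hx')
        exact hfi x x' hx.1 hx.2 hx'.1 hx'.2 (Prod.ext_iff.1 h).2
    · have hxS := hS.card_fst x (Finset.mem_Ico.2 ⟨hx.1, hxn⟩)
      by_cases hxk : x < k
      · have hxf : (x, f x) ∈ S.filter fun p => p.1 = x :=
          Finset.mem_filter.2 ⟨hfk x hx.1 hxk, rfl⟩
        have : (S₀ ∪ A ∪ C).filter (fun p => p.1 = x) =
            insert (x, (n : ℤ)) ((S.filter fun p => p.1 = x).erase (x, f x)) := by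
          ext ⟨x', y⟩
          rw [Finset.mem_filter, hmem, Finset.mem_insert, Finset.mem_erase, Finset.mem_filter]
          simp only [Prod.mk.injEq, ne_eq, not_and]
          constructor
          · rintro ⟨h | h | h, rfl⟩
            · exact Or.inr ⟨fun _ h' => h.2 hxk h', h.1, rfl⟩
            · exact Or.inl ⟨rfl, h.2⟩
            · omega
          · rintro (⟨rfl, rfl⟩ | ⟨h1, h2, rfl⟩)
            · exact ⟨Or.inr (Or.inl ⟨⟨hx.1, hxk⟩, rfl⟩), rfl⟩
            · exact ⟨Or.inl ⟨h2, fun _ h => h1 rfl h⟩, rfl⟩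
        rw [this, Finset.card_insert_of_notMem, Finset.card_erase_of_mem hxf, hxS]
        · omega
        · intro h
          have := hin _ _ (Finset.mem_filter.1 (Finset.mem_erase.1 h).2).1
          omega
      · rw [← hxS]
        congr 1
        ext ⟨x', y⟩
        rw [Finset.mem_filter, hmem, Finset.mem_filter]
        constructor
        · rintro ⟨h | h | h, rfl⟩
          · exact ⟨h.1, rfl⟩
          · omega
          · omega
        · rintro ⟨h, rfl⟩
          exact ⟨Or.inl ⟨h, fun h' => hxk h'.1⟩, rfl⟩
  · intro y hy
    rw [Finset.mem_Ico] at hy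
    push_cast at hy
    rcases (show y ≤ n by omega).eq_or_lt with rfl | hyn
    · rw [← hcard, ← Finset.card_image_of_injective (Finset.Ico 0 (k : ℤ))
        (f := fun x => (x, (n : ℤ))) (fun x x' h => (Prod.ext_iff.1 h).1)]
      congr 1
      ext ⟨x, y⟩
      change _ ↔ (x, y) ∈ A
      rw [Finset.mem_filter, hmem, hA]
      constructor
      · rintro ⟨h | h | ⟨h, x', h', h''⟩, rfl⟩
        · have := hin _ _ h.1
          omega
        · exact h
        · have := hin _ _ (hfk x' h'.1 h'.2)
          omega
      · intro h
        exact ⟨Or.inr (Or.inl h), h.2⟩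
    · have hyS := hS.card_snd y (Finset.mem_Ico.2 ⟨hy.1, hyn⟩)
      by_cases hyk : ∃ x' : ℤ, (0 ≤ x' ∧ x' < k) ∧ f x' = y
      · obtain ⟨x₀, hx₀, rfl⟩ := hyk
        have hxf : (x₀, f x₀) ∈ S.filter fun p => p.2 = f x₀ :=
          Finset.mem_filter.2 ⟨hfk x₀ hx₀.1 hx₀.2, rfl⟩
        have : (S₀ ∪ A ∪ C).filter (fun p => p.2 = f x₀) =
            insert ((n : ℤ), f x₀) ((S.filter fun p => p.2 = f x₀).erase (x₀, f x₀)) := by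
          ext ⟨x, y⟩
          rw [Finset.mem_filter, hmem, Finset.mem_insert, Finset.mem_erase, Finset.mem_filter]
          simp only [Prod.mk.injEq, ne_eq, not_and]
          constructor
          · rintro ⟨h | h | h, rfl⟩
            · refine Or.inr ⟨fun h' _ => h.2 (h' ▸ hx₀.2) ?_, h.1, rfl⟩
              rw [h']
            · omega
            · exact Or.inl ⟨h.1, rfl⟩
          · rintro (⟨rfl, rfl⟩ | ⟨h1, h2, rfl⟩)
            · exact ⟨Or.inr (Or.inr ⟨rfl, x₀, hx₀, rfl⟩), rfl⟩
            · exact ⟨Or.inl ⟨h2, fun h h' => h1 (hfi _ _ (hin _ _ h2).1.1 h hx₀.1 hx₀.2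
                h'.symm) rfl⟩, rfl⟩
        rw [this, Finset.card_insert_of_notMem, Finset.card_erase_of_mem hxf, hyS]
        · omega
        · intro h
          have := hin _ _ (Finset.mem_filter.1 (Finset.mem_erase.1 h).2).1
          omega
      · rw [← hyS]
        congr 1
        ext ⟨x, y'⟩
        rw [Finset.mem_filter, hmem, Finset.mem_filter]
        constructor
        · rintro ⟨h | h | h, rfl⟩
          · exact ⟨h.1, rfl⟩
          · omega
          · exact absurd h.2 hyk
        · rintro ⟨h, rfl⟩
          exact ⟨Or.inl ⟨h, fun h' => hyk ⟨x, ⟨(hin _ _ h).1.1, h'.1⟩, h'.2.symm⟩⟩, rfl⟩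
  · intro a b c hab
    have h1 : (A.filter fun p => b * p.1 - a * p.2 = c).card ≤ 1 := by
      refine Finset.card_le_one.2 ?_
      rintro ⟨x, y⟩ hp ⟨x', y'⟩ hp'
      simp only [Finset.mem_filter, hA] at hp hp'
      obtain ⟨⟨-, rfl⟩, h⟩ := hp
      obtain ⟨⟨-, rfl⟩, h'⟩ := hp'
      rw [mul_left_cancel₀ hab.2.1 (by linarith : b * x = b * x')]
    have h2 : (C.filter fun p => b * p.1 - a * p.2 = c).card ≤ 1 := by
      refine Finset.card_le_one.2 ?_
      rintro ⟨x, y⟩ hp ⟨x', y'⟩ hp'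
      simp only [Finset.mem_filter, hC] at hp hp'
      obtain ⟨⟨rfl, -⟩, h⟩ := hp
      obtain ⟨⟨rfl, -⟩, h'⟩ := hp'
      rw [mul_left_cancel₀ hab.1 (by linarith : a * y = a * y')]
    have h3 : (S₀.filter fun p => b * p.1 - a * p.2 = c).card ≤ B :=
      (Finset.card_le_card (Finset.filter_subset_filter _ (Finset.filter_subset _ _))).trans
        (hS.card_oblique a b c hab)
    rw [Finset.filter_union, Finset.filter_union]
    have h4 := Finset.card_union_le
      ((S₀.filter fun p => b * p.1 - a * p.2 = c) ∪ A.filter fun p => b * p.1 - a * p.2 = c)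
      (C.filter fun p => b * p.1 - a * p.2 = c)
    have h5 := Finset.card_union_le
      (S₀.filter fun p => b * p.1 - a * p.2 = c) (A.filter fun p => b * p.1 - a * p.2 = c)
    omega

theorem IsRegularSelection.exists_add {n k B : ℕ} {S : Finset (ℤ × ℤ)}
    (hS : IsRegularSelection n k B S) (hk : 0 < k) (hkn : k ≤ n) (r : ℕ) :
    ∃ S', IsRegularSelection (n + r) k (B + 2 * r) S' := by
  induction r with
  | zero => exact ⟨S, hS⟩
  | succ r ih =>
    obtain ⟨S', hS'⟩ := ih
    exact hS'.exists_succ hk (by omega)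

theorem exists_isRegularSelection_of_sparse {n k : ℕ} (hk : 10 ^ 37 ≤ k) (hkn : 3 * k ≤ 2 * n) :
    ∃ S, IsRegularSelection n k k S := by
  have hk6 : 1000000 ≤ k := le_trans (by norm_num) hk
  obtain ⟨S, hS⟩ := exists_isRegularSelection_div_eight hk hkn
  obtain ⟨S', hS'⟩ := hS.exists_add (by omega) (by omega) (n % 8)
  rw [Nat.div_add_mod] at hS'
  exact ⟨S', hS'.mono (by omega)⟩

end SparseCase

section DenseCase

/-- The complement of a `j`-regular relation on `[0, n)`. -/
theorem card_compl_relation {n j k : ℕ} (hjk : j + k = n) {Q : ℤ → Prop} [DecidablePred Q]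
    (hQ : ((Finset.Ico 0 (n : ℤ)).filter Q).card = j) :
    ((Finset.Ico 0 (n : ℤ)).filter fun y => ¬ Q y).card = k := by
  have h := Finset.card_filter_add_card_filter_not (s := Finset.Ico 0 (n : ℤ)) Q
  rw [hQ, Int.card_Ico] at h
  omega

theorem card_filter_eq_of_forall_iff {n j : ℕ} {u v : ℤ} {Q : ℤ → Prop} [DecidablePred Q]
    (h : ∀ y : ℤ, (0 ≤ y ∧ y < n) ∧ Q y ↔ u ≤ y ∧ y < v) (huv : v = u + j) :
    ((Finset.Ico 0 (n : ℤ)).filter Q).card = j := by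
  have : (Finset.Ico 0 (n : ℤ)).filter Q = Finset.Ico u v := by
    ext y
    rw [Finset.mem_filter, Finset.mem_Ico, Finset.mem_Ico, h]
  rw [this, Int.card_Ico]
  omega

open scoped Classical in
/-- There is a `j`-regular relation on `[0, n)` containing two prescribed `j × j` blocks. -/
theorem exists_regular_relation_with_blocks {n j : ℕ} (hj : 3 * j ≤ n) :
    ∃ Q : ℤ → ℤ → Prop,
      (∀ x ∈ Finset.Ico 0 (n : ℤ), ((Finset.Ico 0 (n : ℤ)).filter fun y => Q x y).card = j) ∧
      (∀ y ∈ Finset.Ico 0 (n : ℤ), ((Finset.Ico 0 (n : ℤ)).filter fun x => Q x y).card = j) ∧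
      (∀ x y : ℤ, x < j → y < j → Q x y) ∧
      ∀ x y : ℤ, j ≤ x → x < 2 * j → n - 2 * j ≤ y → y < n - j → Q x y := by
  obtain ⟨R, hR1, hR2⟩ := exists_regular_relation (Finset.Ico 0 ((n : ℤ) - 2 * j)) j
    (by rw [Int.card_Ico]; omega)
  have hcard : ∀ (A : Finset ℤ) (p : ℤ → Prop), {y | y ∈ A ∧ p y}.ncard = (A.filter p).card := by
    intro A p
    rw [← Set.ncard_coe_finset, Finset.coe_filter]
  simp only [hcard] at hR1 hR2
  let v : ℤ → ℤ := fun y => if y < n - 2 * j then y - j else y - 2 * j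
  obtain ⟨Q, hQ⟩ : ∃ Q : ℤ → ℤ → Prop, ∀ x y, Q x y ↔ (x < j ∧ y < j) ∨
      (j ≤ x ∧ x < 2 * j ∧ n - 2 * j ≤ y ∧ y < n - j) ∨
      (2 * j ≤ x ∧ (j ≤ y ∧ y < n - 2 * j ∨ n - j ≤ y) ∧ R (x - 2 * j) (v y)) :=
    ⟨_, fun _ _ => Iff.rfl⟩
  refine ⟨Q, ?_, ?_, ?_, ?_⟩
  · intro x hx
    rw [Finset.mem_Ico] at hx
    rcases lt_or_ge x j with h1 | h1
    · refine card_filter_eq_of_forall_iff (u := 0) (v := j) (fun y => ?_) (by omega)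
      rw [hQ]
      constructor
      · rintro ⟨h, h' | h' | h'⟩ <;> omega
      · intro h
        exact ⟨by omega, Or.inl (by omega)⟩
    rcases lt_or_ge x (2 * j) with h2 | h2
    · refine card_filter_eq_of_forall_iff (u := n - 2 * j) (v := n - j) (fun y => ?_) (by omega)
      rw [hQ]
      constructor
      · rintro ⟨h, h' | h' | h'⟩ <;> omega
      · intro h
        exact ⟨by omega, Or.inr (Or.inl (by omega))⟩
    refine Eq.trans ?_ (hR2 (x - 2 * j) (Finset.mem_Ico.2 (by omega)))
    refine Finset.card_bij (fun y _ => v y) ?_ ?_ ?_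
    · intro y hy
      rw [Finset.mem_filter, Finset.mem_Ico, hQ] at hy
      obtain ⟨h, h' | h' | h'⟩ := hy
      · omega
      · omega
      · refine Finset.mem_filter.2 ⟨Finset.mem_Ico.2 ?_, h'.2.2⟩
        have h3 := h'.2.1
        simp only [v]
        split_ifs <;> omega
    · intro y hy y' hy' h
      rw [Finset.mem_filter, Finset.mem_Ico, hQ] at hy hy'
      have h3 : j ≤ y ∧ y < n - 2 * j ∨ n - j ≤ y := by
        obtain ⟨h, h' | h' | h'⟩ := hy
        · omega
        · omega
        · exact h'.2.1
      have h3' : j ≤ y' ∧ y' < n - 2 * j ∨ n - j ≤ y' := by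
        obtain ⟨h, h' | h' | h'⟩ := hy'
        · omega
        · omega
        · exact h'.2.1
      simp only [v] at h
      split_ifs at h <;> omega
    · intro u hu
      obtain ⟨hu, hR⟩ := Finset.mem_filter.1 hu
      rw [Finset.mem_Ico] at hu
      obtain ⟨y, hy, hvy⟩ : ∃ y : ℤ, (0 ≤ y ∧ y < n ∧ (j ≤ y ∧ y < n - 2 * j ∨ n - j ≤ y)) ∧
          v y = u := by
        rcases lt_or_ge u (n - 3 * j) with h3 | h3
        · refine ⟨u + j, by omega, ?_⟩
          simp only [v]
          split_ifs <;> omega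
        · refine ⟨u + 2 * j, by omega, ?_⟩
          simp only [v]
          split_ifs <;> omega
      exact ⟨y, Finset.mem_filter.2 ⟨Finset.mem_Ico.2 ⟨hy.1, hy.2.1⟩,
        (hQ _ _).2 (Or.inr (Or.inr ⟨h2, hy.2.2, hvy ▸ hR⟩))⟩, hvy⟩
  · intro y hy
    rw [Finset.mem_Ico] at hy
    rcases lt_or_ge y j with h1 | h1
    · refine card_filter_eq_of_forall_iff (u := 0) (v := j) (fun x => ?_) (by omega)
      rw [hQ]
      constructor
      · rintro ⟨h, h' | h' | h'⟩ <;> omega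
      · intro h
        exact ⟨by omega, Or.inl (by omega)⟩
    by_cases h2 : n - 2 * j ≤ y ∧ y < n - j
    · refine card_filter_eq_of_forall_iff (u := j) (v := 2 * j) (fun x => ?_) (by omega)
      rw [hQ]
      constructor
      · rintro ⟨h, h' | h' | h'⟩ <;> omega
      · intro h
        exact ⟨by omega, Or.inr (Or.inl (by omega))⟩
    refine Eq.trans ?_ (hR1 (v y) (Finset.mem_Ico.2 (by simp only [v]; split_ifs <;> omega)))
    refine Finset.card_bij (fun x _ => x - 2 * j) ?_ ?_ ?_
    · intro x hx
      rw [Finset.mem_filter, Finset.mem_Ico, hQ] at hx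
      obtain ⟨h, h' | h' | h'⟩ := hx
      · omega
      · omega
      · exact Finset.mem_filter.2 ⟨Finset.mem_Ico.2 (by omega), h'.2.2⟩
    · intro x _ x' _ h
      linarith
    · intro u hu
      obtain ⟨hu, hR⟩ := Finset.mem_filter.1 hu
      rw [Finset.mem_Ico] at hu
      refine ⟨u + 2 * j, Finset.mem_filter.2 ⟨Finset.mem_Ico.2 (by omega),
        (hQ _ _).2 (Or.inr (Or.inr ⟨by omega, by omega, ?_⟩))⟩, by ring⟩
      rwa [add_sub_cancel_right]
  · exact fun x y h1 h2 => (hQ x y).2 (Or.inl ⟨h1, h2⟩)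
  · exact fun x y h1 h2 h3 h4 => (hQ x y).2 (Or.inr (Or.inl ⟨h1, h2, h3, h4⟩))

theorem exists_isRegularSelection_of_dense {n k : ℕ} (hk : 100 ≤ k) (hkn : k ≤ n)
    (hnk : 2 * n ≤ 3 * k) : ∃ S, IsRegularSelection n k k S := by
  classical
  obtain ⟨j, rfl⟩ := Nat.exists_eq_add_of_le' hkn
  obtain ⟨Q, hQ1, hQ2, hQ3, hQ4⟩ := exists_regular_relation_with_blocks
    (n := j + k) (j := j) (by omega)
  let S := (Finset.Ico 0 ((j + k : ℕ) : ℤ) ×ˢ Finset.Ico 0 ((j + k : ℕ) : ℤ)).filter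
    fun p => ¬ Q p.1 p.2
  have hmem : ∀ x y, (x, y) ∈ S ↔
      (x ∈ Finset.Ico 0 ((j + k : ℕ) : ℤ) ∧ y ∈ Finset.Ico 0 ((j + k : ℕ) : ℤ)) ∧ ¬ Q x y := by
    intro x y
    rw [Finset.mem_filter, Finset.mem_product]
  refine ⟨S, Finset.filter_subset _ _, ?_, ?_, ?_⟩
  · intro x hx
    rw [← card_compl_relation rfl (hQ1 x hx)]
    refine Finset.card_bij' (fun p _ => p.2) (fun y _ => (x, y)) ?_ ?_ ?_ ?_
    · rintro ⟨x', y⟩ hp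
      obtain ⟨h, rfl⟩ := Finset.mem_filter.1 hp
      have h := (hmem _ _).1 h
      exact Finset.mem_filter.2 ⟨h.1.2, h.2⟩
    · intro y hy
      have hy := Finset.mem_filter.1 hy
      exact Finset.mem_filter.2 ⟨(hmem _ _).2 ⟨⟨hx, hy.1⟩, hy.2⟩, rfl⟩
    · rintro ⟨x', y⟩ hp
      rw [← (Finset.mem_filter.1 hp).2]
    · intro y _
      rfl
  · intro y hy
    rw [← card_compl_relation rfl (hQ2 y hy)]
    refine Finset.card_bij' (fun p _ => p.1) (fun x _ => (x, y)) ?_ ?_ ?_ ?_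
    · rintro ⟨x, y'⟩ hp
      obtain ⟨h, rfl⟩ := Finset.mem_filter.1 hp
      have h := (hmem _ _).1 h
      exact Finset.mem_filter.2 ⟨h.1.1, h.2⟩
    · intro x hx
      have hx := Finset.mem_filter.1 hx
      exact Finset.mem_filter.2 ⟨(hmem _ _).2 ⟨⟨hx.1, hy⟩, hx.2⟩, rfl⟩
    · rintro ⟨x, y'⟩ hp
      rw [← (Finset.mem_filter.1 hp).2]
    · intro x _
      rfl
  · intro a b c hab
    rcases hab.one_le_dirHeight.eq_or_lt with h | h
    · have h1 : a.natAbs ≤ 1 := (le_max_left _ _).trans h.ge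
      have h2 : b.natAbs ≤ 1 := (le_max_right _ _).trans h.ge
      have h3 := hab.1
      have h4 := hab.2.1
      have hkey : ∀ x y : ℤ, (x, y) ∈ S → (0 ≤ x ∧ x < j + k ∧ 0 ≤ y ∧ y < j + k) ∧
          ¬ (x < j ∧ y < j) ∧ ¬ (j ≤ x ∧ x < 2 * j ∧ k - j ≤ y ∧ y < k) := by
        intro x y hxy
        obtain ⟨⟨h1, h2⟩, h3⟩ := (hmem _ _).1 hxy
        rw [Finset.mem_Ico] at h1 h2
        push_cast at h1 h2
        refine ⟨by omega, fun h => h3 (hQ3 x y h.1 h.2), fun h => h3 (hQ4 x y h.1 h.2.1 ?_ ?_)⟩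
        · push_cast
          omega
        · push_cast
          omega
      have hor : (∃ f : ℤ, ∀ x y : ℤ, b * x - a * y = c → y = x + f) ∨
          ∃ f : ℤ, ∀ x y : ℤ, b * x - a * y = c → y = f - x := by
        rcases (by omega : a = 1 ∨ a = -1) with rfl | rfl <;>
        rcases (by omega : b = 1 ∨ b = -1) with rfl | rfl
        · exact Or.inl ⟨-c, fun x y h => by linarith⟩
        · exact Or.inr ⟨-c, fun x y h => by linarith⟩
        · exact Or.inr ⟨c, fun x y h => by linarith⟩
        · exact Or.inl ⟨c, fun x y h => by linarith⟩
      rcases hor with ⟨f, hf⟩ | ⟨f, hf⟩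
      · have : (Finset.Ico (j : ℤ) (j + k)).card = k := by
          rw [Int.card_Ico]
          omega
        refine le_trans ?_ this.le
        refine Finset.card_le_card_of_injOn (fun p => max p.1 p.2) ?_ ?_
        · rintro ⟨x, y⟩ hp
          have h5 := hkey x y (Finset.mem_filter.1 hp).1
          refine Finset.mem_coe.2 (Finset.mem_Ico.2 ?_)
          change (j : ℤ) ≤ max x y ∧ max x y < j + k
          omega
        · rintro ⟨x, y⟩ hp ⟨x', y'⟩ hp' he
          have h5 := hf x y (Finset.mem_filter.1 hp).2
          have h6 := hf x' y' (Finset.mem_filter.1 hp').2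
          have he : max x y = max x' y' := he
          rw [Prod.mk.injEq]
          omega
      · have : (Finset.Ico |(j : ℤ) + k - 1 - f| (j + k) \
            Finset.Ico (j + |(j : ℤ) + k - 1 - f|) (2 * j)).card ≤ k := by
          rcases le_total |(j : ℤ) + k - 1 - f| j with hw | hw
          · rw [Finset.card_sdiff_of_subset, Int.card_Ico, Int.card_Ico]
            · omega
            · intro t ht
              rw [Finset.mem_Ico] at ht ⊢
              omega
          · refine (Finset.card_le_card Finset.sdiff_subset).trans ?_
            rw [Int.card_Ico]
            omega
        refine le_trans ?_ this
        refine Finset.card_le_card_of_injOn (fun p => max p.1 (j + k - 1 - p.2)) ?_ ?_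
        · rintro ⟨x, y⟩ hp
          have h5 := hkey x y (Finset.mem_filter.1 hp).1
          have h6 := hf x y (Finset.mem_filter.1 hp).2
          refine Finset.mem_coe.2 (Finset.mem_sdiff.2 ?_)
          rw [Finset.mem_Ico, Finset.mem_Ico]
          change (_ ≤ max x (j + k - 1 - y) ∧ max x (j + k - 1 - y) < j + k) ∧
            ¬ (_ ≤ max x (j + k - 1 - y) ∧ max x (j + k - 1 - y) < 2 * j)
          rcases abs_cases ((j : ℤ) + k - 1 - f) with h7 | h7 <;> omega
        · rintro ⟨x, y⟩ hp ⟨x', y'⟩ hp' he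
          have h5 := hf x y (Finset.mem_filter.1 hp).2
          have h6 := hf x' y' (Finset.mem_filter.1 hp').2
          have he : max x (j + k - 1 - y) = max x' (j + k - 1 - y') := he
          rw [Prod.mk.injEq]
          omega
    · refine (card_le_of_line hab (j + k) (c := c) ?_ ?_).trans ?_
      · exact (Finset.filter_subset _ _).trans (Finset.filter_subset _ _)
      · exact fun p hp => (Finset.mem_filter.1 hp).2
      · have : (j + k) / dirHeight a b ≤ (j + k) / 2 := Nat.div_le_div_left h (by norm_num)
        omega

end DenseCase

section LatticePoints

theorem exists_isRegularSelection {n k : ℕ} (hk : 10 ^ 37 ≤ k) (hkn : k ≤ n) :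
    ∃ S, IsRegularSelection n k k S := by
  rcases le_total (3 * k) (2 * n) with h | h
  · exact exists_isRegularSelection_of_sparse hk h
  · exact exists_isRegularSelection_of_dense (le_trans (by norm_num) hk) hkn h

theorem IsRegularSelection.card_eq {n k B : ℕ} {S : Finset (ℤ × ℤ)}
    (hS : IsRegularSelection n k B S) : S.card = k * n := by
  rw [Finset.card_eq_sum_card_fiberwise (f := Prod.fst) (t := Finset.Ico 0 (n : ℤ))
    (fun p hp => (Finset.mem_product.1 (hS.subset hp)).1), Finset.sum_congr rfl hS.card_fst]
  simp [mul_comm]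

/-- In a regular selection, at most `k` points are collinear. -/
theorem IsRegularSelection.card_le_of_collinear {n k : ℕ} {S : Finset (ℤ × ℤ)}
    (hS : IsRegularSelection n k k S) {A : Finset (ℤ × ℤ)} (hA : A ⊆ S) {P Q : ℤ × ℤ} (hP : P ∈ A)
    (hPQ : P ≠ Q)
    (h : ∀ R ∈ A, (R.1 - P.1) * (Q.2 - P.2) = (R.2 - P.2) * (Q.1 - P.1)) : A.card ≤ k := by
  have hPS := Finset.mem_product.1 (hS.subset (hA hP))
  by_cases hu : Q.1 - P.1 = 0
  · have hv : Q.2 - P.2 ≠ 0 := fun hv => hPQ (Prod.ext (by linarith) (by linarith))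
    rw [← hS.card_fst P.1 hPS.1]
    refine Finset.card_le_card fun R hR => Finset.mem_filter.2 ⟨hA hR, ?_⟩
    have h1 := h R hR
    rw [hu, mul_zero, mul_eq_zero, or_iff_left hv] at h1
    linarith
  by_cases hv : Q.2 - P.2 = 0
  · rw [← hS.card_snd P.2 hPS.2]
    refine Finset.card_le_card fun R hR => Finset.mem_filter.2 ⟨hA hR, ?_⟩
    have h1 := (h R hR).symm
    rw [hv, mul_zero, mul_eq_zero, or_iff_left hu] at h1
    linarith
  obtain ⟨g, a, b, hg, hab, ha, hb⟩ :=
    Int.exists_gcd_one' (Int.gcd_pos_of_ne_zero_left (Q.2 - P.2) hu)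
  have hg0 : (g : ℤ) ≠ 0 := by exact_mod_cast hg.ne'
  refine (Finset.card_le_card fun R hR => Finset.mem_filter.2 ⟨hA hR, ?_⟩).trans
    (hS.card_oblique a b (b * P.1 - a * P.2) ⟨?_, ?_, Int.isCoprime_iff_gcd_eq_one.2 hab⟩)
  · have h1 := h R hR
    rw [ha, hb] at h1
    have h2 : (R.1 - P.1) * b = (R.2 - P.2) * a :=
      mul_right_cancel₀ hg0 (by linarith)
    linarith
  · rintro rfl
    exact hu (by rw [ha, zero_mul])
  · rintro rfl
    exact hv (by rw [hb, zero_mul])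

theorem IsLine.mul_eq_mul {L : AffineSubspace ℝ (ℝ × ℝ)} (hL : IsLine L) {p q r : ℝ × ℝ}
    (hp : p ∈ L) (hq : q ∈ L) (hr : r ∈ L) (hpq : p ≠ q) :
    (r.1 - p.1) * (q.2 - p.2) = (r.2 - p.2) * (q.1 - p.1) := by
  have hne : (⟨q -ᵥ p, AffineSubspace.vsub_mem_direction hq hp⟩ : L.direction) ≠ 0 := by
    intro h
    exact hpq (sub_eq_zero.1 (congrArg Subtype.val h)).symm
  obtain ⟨t, ht⟩ := (finrank_eq_one_iff_of_nonzero' _ hne).1 hL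
    ⟨r -ᵥ p, AffineSubspace.vsub_mem_direction hr hp⟩
  have ht : t • (q - p) = r - p := Subtype.ext_iff.1 ht
  have h1 := congrArg Prod.fst ht
  have h2 := congrArg Prod.snd ht
  simp only [Prod.smul_fst, Prod.smul_snd, Prod.fst_sub, Prod.snd_sub, smul_eq_mul] at h1 h2
  rw [← h1, ← h2]
  ring

/-- The point of `[n]²` corresponding to a point of `[0, n)²`. -/
def toPlane (p : ℤ × ℤ) : ℝ × ℝ := ((p.1 + 1 : ℤ), (p.2 + 1 : ℤ))

theorem toPlane_injective : Function.Injective toPlane := by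
  intro p q h
  have h1 := congrArg Prod.fst h
  have h2 := congrArg Prod.snd h
  simp only [toPlane, Int.cast_inj, add_left_inj] at h1 h2
  exact Prod.ext h1 h2

end LatticePoints

/-- For integers `10^37 ≤ k ≤ n` there is a subset `S` of the grid `[n]²`
of size exactly `k * n` such that every affine line in `ℝ²` contains at most `k` points of `S`. -/
theorem no_k_plus_one_in_line (n k : ℕ) (hk : 10 ^ 37 ≤ k) (hkn : k ≤ n) :
    ∃ S : Set (ℝ × ℝ), S ⊆ grid2 n ∧ S.ncard = k * n ∧
      ∀ L : AffineSubspace ℝ (ℝ × ℝ), IsLine L → (S ∩ (L : Set (ℝ × ℝ))).ncard ≤ k := by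
  classical
  obtain ⟨S, hS⟩ := exists_isRegularSelection hk hkn
  refine ⟨toPlane '' S, ?_, ?_, fun L hL => ?_⟩
  · rintro _ ⟨p, hp, rfl⟩
    have h := Finset.mem_product.1 (hS.subset hp)
    rw [Finset.mem_Ico, Finset.mem_Ico] at h
    exact ⟨p.1 + 1, p.2 + 1, by omega, by omega, by omega, by omega, rfl⟩
  · rw [Set.ncard_image_of_injective _ toPlane_injective, Set.ncard_coe_finset, hS.card_eq]
  · let A := S.filter fun p => toPlane p ∈ L
    have hA : toPlane '' (S : Set (ℤ × ℤ)) ∩ L = toPlane '' (A : Set (ℤ × ℤ)) := by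
      ext q
      constructor
      · rintro ⟨⟨p, hp, rfl⟩, hq⟩
        exact ⟨p, Finset.mem_coe.2 (Finset.mem_filter.2 ⟨hp, hq⟩), rfl⟩
      · rintro ⟨p, hp, rfl⟩
        have hp := Finset.mem_filter.1 (Finset.mem_coe.1 hp)
        exact ⟨⟨p, hp.1, rfl⟩, hp.2⟩
    rw [hA, Set.ncard_image_of_injective _ toPlane_injective, Set.ncard_coe_finset]
    rcases le_or_gt A.card 1 with h1 | h1
    · exact h1.trans (le_trans (by norm_num) hk)
    · obtain ⟨P, hP, Q, hQ, hPQ⟩ := Finset.one_lt_card.1 h1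
      refine hS.card_le_of_collinear (Finset.filter_subset _ _) hP hPQ fun R hR => ?_
      have h := hL.mul_eq_mul (Finset.mem_filter.1 hP).2 (Finset.mem_filter.1 hQ).2
        (Finset.mem_filter.1 hR).2 (toPlane_injective.ne hPQ)
      simp only [toPlane] at h
      norm_cast at h
      linarith
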